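/- arXiv:2511.04817 — 14 statements merged into one kernel-verified Lean document; each statement's English description precedes it below -/
import Mathlib

section
/- Let 𝒟 be a Borel probability measure on [0,1]^n, let γ ≥ 0, and let α_1,…,α_n ≥ 0 be shares. Let A_1,…,A_n be measurable subsets of [0,1]^n with 𝒟(A_1 ∪ ⋯ ∪ A_n) ≤ Σ_{i=1}^n α_i. Suppose that for every nonempty S ⊆ {1,…,n} there exist positive reals β_i (i ∈ S) such that the half-space H = {x ∈ [0,1]^n : Σ_{i∈S} x_i/β_i ≥ 1} satisfies 𝒟(H) ≥ Σ_{i∈S} α_i and (1+γ)·Σ_{i∈S} ∫_{A_i} (x_i/β_i) d𝒟(x) ≥ Σ_{i∈S} ∫_H (x_i/β_i) d𝒟(x). Then for every nonempty S ⊆ {1,…,n} and every measurable A' ⊆ [0,1]^n with 𝒟(A') ≤ Σ_{i∈S} α_i, there exists i ∈ S with (1+γ)·∫_{A_i} x_i d𝒟(x) ≥ ∫_{A'} x_i d𝒟(x). -/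
open MeasureTheory

/-- A bathtub principle: on a superlevel set `{x ∈ K | c ≤ f x}` with `0 ≤ c`, the integral
of `f` dominates its integral over any subset of `K` of no larger measure. -/
theorem setIntegral_le_setIntegral_superlevel {Ω : Type*} [MeasurableSpace Ω] {μ : Measure Ω}
    [IsFiniteMeasure μ] {f : Ω → ℝ} (hf : Integrable f μ) {c : ℝ} (hc : 0 ≤ c) {K B : Set Ω}
    (hB : MeasurableSet B) (hBK : B ⊆ K) (hK : MeasurableSet {x | x ∈ K ∧ c ≤ f x})
    (hle : μ B ≤ μ {x | x ∈ K ∧ c ≤ f x}) :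
    ∫ x in B, f x ∂μ ≤ ∫ x in {x | x ∈ K ∧ c ≤ f x}, f x ∂μ := by
  set H : Set Ω := {x | x ∈ K ∧ c ≤ f x}
  have hg : Integrable (fun x => f x - c) μ := hf.sub (integrable_const c)
  have key : ∫ x in B, (f x - c) ∂μ ≤ ∫ x in H, (f x - c) ∂μ := by
    rw [← integral_indicator hB, ← integral_indicator hK]
    refine integral_mono (hg.indicator hB) (hg.indicator hK) fun x => ?_
    by_cases hxH : x ∈ H
    · rw [Set.indicator_of_mem hxH]
      exact Set.indicator_apply_le' (fun _ => le_rfl) fun _ => sub_nonneg.2 hxH.2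
    · rw [Set.indicator_of_notMem hxH]
      refine Set.indicator_apply_le' (fun hxB => ?_) fun _ => le_rfl
      exact sub_nonpos.2 (le_of_not_ge fun h => hxH ⟨hBK hxB, h⟩)
  rw [integral_sub hf.integrableOn (integrable_const c),
    integral_sub hf.integrableOn (integrable_const c), setIntegral_const, setIntegral_const,
    smul_eq_mul, smul_eq_mul] at key
  have hreal : μ.real B ≤ μ.real H := ENNReal.toReal_mono (measure_ne_top μ H) hle
  nlinarith [mul_le_mul_of_nonneg_right hreal hc]

/-- If an ex-ante allocation policy `A` (measurable subsets of the cube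
`[0,1]^n`) is feasible and, for every nonempty coalition `S`, there is a half-space
`H = {x : ∑_{i∈S} x_i/β_i ≥ 1}` of measure at least the coalition's share whose
β-scaled coalition value is within a `(1+γ)` factor of that of `A`, then `A` is in the
`γ`-approximate ex-ante core. -/
theorem statement0 {n : ℕ} (μ : Measure (Fin n → ℝ)) [IsProbabilityMeasure μ]
    (hsupp : μ {x | ¬ ∀ i, x i ∈ Set.Icc (0 : ℝ) 1} = 0)
    (γ : ℝ) (hγ : 0 ≤ γ) (α : Fin n → ℝ) (hα : ∀ i, 0 ≤ α i)
    (A : Fin n → Set (Fin n → ℝ))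
    (hAmeas : ∀ i, MeasurableSet (A i))
    (hAsub : ∀ i, A i ⊆ {x | ∀ j, x j ∈ Set.Icc (0 : ℝ) 1})
    (hfeas : μ (⋃ i, A i) ≤ ENNReal.ofReal (∑ i, α i))
    (hhalf : ∀ S : Finset (Fin n), S.Nonempty →
      ∃ β : Fin n → ℝ, (∀ i ∈ S, 0 < β i) ∧
        ENNReal.ofReal (∑ i ∈ S, α i) ≤
          μ {x | (∀ j, x j ∈ Set.Icc (0 : ℝ) 1) ∧ 1 ≤ ∑ j ∈ S, x j / β j} ∧
        ∑ i ∈ S, ∫ x in {x : Fin n → ℝ |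
              (∀ j, x j ∈ Set.Icc (0 : ℝ) 1) ∧ 1 ≤ ∑ j ∈ S, x j / β j},
            x i / β i ∂μ ≤
          (1 + γ) * ∑ i ∈ S, ∫ x in A i, x i / β i ∂μ) :
    ∀ S : Finset (Fin n), S.Nonempty →
      ∀ A' : Set (Fin n → ℝ), MeasurableSet A' →
        A' ⊆ {x | ∀ j, x j ∈ Set.Icc (0 : ℝ) 1} →
        μ A' ≤ ENNReal.ofReal (∑ i ∈ S, α i) →
        ∃ i ∈ S, ∫ x in A', x i ∂μ ≤ (1 + γ) * ∫ x in A i, x i ∂μ := by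
  intro S hS A' hA' hA'sub hA'le
  obtain ⟨β, hβ, hHle, hval⟩ := hhalf S hS
  by_contra! hcon
  have hint : ∀ i, Integrable (fun x : Fin n → ℝ => x i) μ := fun i => by
    refine Integrable.of_bound (measurable_pi_apply i).aestronglyMeasurable 1 ?_
    have hae : ∀ᵐ x ∂μ, ∀ j, x j ∈ Set.Icc (0 : ℝ) 1 := hsupp
    filter_upwards [hae] with x hx
    rw [Real.norm_of_nonneg (hx i).1]
    exact (hx i).2
  have hint_div : ∀ i, Integrable (fun x : Fin n → ℝ => x i / β i) μ := fun i =>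
    (hint i).div_const _
  have hH : MeasurableSet {x : Fin n → ℝ |
      x ∈ {x : Fin n → ℝ | ∀ j, x j ∈ Set.Icc (0 : ℝ) 1} ∧ 1 ≤ ∑ j ∈ S, x j / β j} := by
    have hcube : MeasurableSet {x : Fin n → ℝ | ∀ j, x j ∈ Set.Icc (0 : ℝ) 1} := by
      rw [Set.ofPred_forall]
      exact MeasurableSet.iInter fun j => measurable_pi_apply j measurableSet_Icc
    have hsum : Measurable fun x : Fin n → ℝ => ∑ j ∈ S, x j / β j := by fun_prop
    exact hcube.inter (measurableSet_le measurable_const hsum)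
  have hbath := setIntegral_le_setIntegral_superlevel
    (integrable_finsetSum S fun i _ => hint_div i) zero_le_one hA' hA'sub hH
    (hA'le.trans hHle)
  rw [integral_finsetSum S fun i _ => (hint_div i).integrableOn,
    integral_finsetSum S fun i _ => (hint_div i).integrableOn] at hbath
  have hlt : (1 + γ) * ∑ i ∈ S, ∫ x in A i, x i / β i ∂μ
      < ∑ i ∈ S, ∫ x in A', x i / β i ∂μ := by
    rw [Finset.mul_sum]
    refine Finset.sum_lt_sum_of_nonempty hS fun i hi => ?_
    rw [integral_div, integral_div, ← mul_div_assoc]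
    exact div_lt_div_of_pos_right (hcon i hi) (hβ i hi)
  exact absurd (hbath.trans hval) (not_le.2 hlt)
end

section
/- Let (A*, p) be a one-shot mechanism for allocating a single excludable public good of cost 1 among n agents satisfying (IR) and (CC). Let η ∈ ℝ, and suppose that for every ε > 0 there exists Ṽ ∈ [0,∞)^n with Σ_i Ṽ_i > 0 such that 1[A*(Ṽ) ≠ ∅] + Σ_{i∉A*(Ṽ)} Ṽ_i > (η − ε)·min(1, Σ_i Ṽ_i). Then sup_{Ṽ ∈ [0,∞)^n} DWL(Ṽ) ≥ η − 1 (the supremum taken in [0,∞]). -/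
/-- For an (IR) and (CC) single-good mechanism `(A*, p)`: if for every
`ε > 0` there is a nonnegative report `Ṽ` with `∑_i Ṽ_i > 0` whose social cost
`1[A*(Ṽ) ≠ ∅] + ∑_{i∉A*(Ṽ)} Ṽ_i` exceeds `(η − ε)` times the minimum social cost
`min(1, ∑_i Ṽ_i)`, then `sup_Ṽ DWL(Ṽ) ≥ η − 1` (supremum in `[0,∞]`). -/
theorem statement5 {n : ℕ}
    (Astar : (Fin n → ℝ) → Finset (Fin n)) (p : (Fin n → ℝ) → Fin n → ℝ)
    (hIR : ∀ v : Fin n → ℝ, (∀ i, 0 ≤ v i) → ∀ i,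
      (i ∈ Astar v → p v i ≤ v i) ∧ (i ∉ Astar v → p v i = 0))
    (hCC : ∀ v : Fin n → ℝ, (∀ i, 0 ≤ v i) → Astar v ≠ ∅ → 1 ≤ ∑ i, p v i)
    (η : ℝ)
    (hη : ∀ ε : ℝ, 0 < ε → ∃ v : Fin n → ℝ, (∀ i, 0 ≤ v i) ∧ 0 < ∑ i, v i ∧
      (η - ε) * min 1 (∑ i, v i) <
        (if Astar v ≠ ∅ then (1 : ℝ) else 0) + ∑ i ∈ (Astar v)ᶜ, v i) :
    ENNReal.ofReal (η - 1) ≤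
      ⨆ v : {v : Fin n → ℝ // ∀ i, 0 ≤ v i},
        ENNReal.ofReal (max (∑ i ∈ (Astar v.1)ᶜ, v.1 i + ∑ i, p v.1 i - 1) 0) := by
  by_contra! hlt
  set s := ⨆ v : {v : Fin n → ℝ // ∀ i, 0 ≤ v i},
    ENNReal.ofReal (max (∑ i ∈ (Astar v.1)ᶜ, v.1 i + ∑ i, p v.1 i - 1) 0)
  have hs_top : s ≠ ⊤ := ne_top_of_lt hlt
  have hs_lt : s.toReal < η - 1 := (ENNReal.lt_ofReal_iff_toReal_lt hs_top).1 hlt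
  have hs_nonneg : 0 ≤ s.toReal := ENNReal.toReal_nonneg
  obtain ⟨v, hv, hv_pos, hv_cost⟩ := hη (η - 1 - s.toReal) (by linarith)
  have hdwl : ∑ i ∈ (Astar v)ᶜ, v i + ∑ i, p v i - 1 ≤ s.toReal :=
    (le_max_left _ 0).trans <| (ENNReal.ofReal_le_iff_le_toReal hs_top).1 <|
      le_iSup (fun v : {v : Fin n → ℝ // ∀ i, 0 ≤ v i} =>
        ENNReal.ofReal (max (∑ i ∈ (Astar v.1)ᶜ, v.1 i + ∑ i, p v.1 i - 1) 0)) ⟨v, hv⟩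
  rw [show η - (η - 1 - s.toReal) = s.toReal + 1 by ring] at hv_cost
  by_cases hA : Astar v = ∅
  · have hp : ∑ i, p v i = 0 :=
      Finset.sum_eq_zero fun i _ => (hIR v hv i).2 (by simp [hA])
    simp only [hA, Finset.compl_empty, hp, ne_eq, not_true_eq_false, if_false, zero_add]
      at hdwl hv_cost
    rcases le_total 1 (∑ i, v i) with h | h
    · rw [min_eq_left h] at hv_cost
      linarith
    · rw [min_eq_right h] at hv_cost
      nlinarith
  · have hcover := hCC v hv hA
    have hsum : ∑ i, p v i ≤ ∑ i, v i := by
      refine Finset.sum_le_sum fun i _ => ?_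
      by_cases hi : i ∈ Astar v
      · exact (hIR v hv i).1 hi
      · exact ((hIR v hv i).2 hi).trans_le (hv i)
    rw [if_pos hA, min_eq_left (hcover.trans hsum)] at hv_cost
    linarith
end

section
/- For the Moulin mechanism on n ≥ 1 agents and every V ∈ [0,∞)^n: Σ_{i∉A*(V)} V_i + Σ_{i=1}^n p_i(V) ≤ H_n, where H_n = Σ_{j=1}^n 1/j is the n-th harmonic number. Equivalently, its dead-weight loss satisfies DWL(V) = (Σ_{i∉A*(V)} V_i + Σ_i p_i(V) − 1)⁺ ≤ H_n − 1. -/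
/-- The set `K(V) = {k ∈ {1,…,n} : #{i : V_i ≥ 1/k} ≥ k}` of the Moulin mechanism. -/
noncomputable def moulinK {n : ℕ} (V : Fin n → ℝ) : Finset ℕ :=
  (Finset.Icc 1 n).filter fun k =>
    k ≤ (Finset.univ.filter fun i : Fin n => 1 / (k : ℝ) ≤ V i).card

/-- The allocation rule of the Moulin mechanism: if `K(V) ≠ ∅`, allocate to
`{i : V_i ≥ 1/k*(V)}` where `k*(V) = max K(V)`; otherwise allocate to nobody. -/
noncomputable def moulinA {n : ℕ} (V : Fin n → ℝ) : Finset (Fin n) :=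
  if h : (moulinK V).Nonempty then
    Finset.univ.filter fun i : Fin n => 1 / (((moulinK V).max' h : ℕ) : ℝ) ≤ V i
  else ∅

/-- The payment rule of the Moulin mechanism: allocated agents pay `1/k*(V)`,
everyone else pays `0`. -/
noncomputable def moulinP {n : ℕ} (V : Fin n → ℝ) (i : Fin n) : ℝ :=
  if h : (moulinK V).Nonempty then
    if i ∈ moulinA V then 1 / (((moulinK V).max' h : ℕ) : ℝ) else 0
  else 0

theorem sum_le_sum_Ioc_one_div_of_exists_lt {ι : Type*} [DecidableEq ι] (V : ι → ℝ) (m : ℕ)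
    (S : Finset ι)
    (h : ∀ T ⊆ S, T.Nonempty → ∃ i ∈ T, V i < 1 / ((m + T.card : ℕ) : ℝ)) :
    ∑ i ∈ S, V i ≤ ∑ j ∈ Finset.Ioc m (m + S.card), (1 : ℝ) / j := by
  induction S using Finset.strongInduction with
  | H S ih =>
    rcases S.eq_empty_or_nonempty with rfl | hS
    · simp
    · obtain ⟨i, hi, hlt⟩ := h S subset_rfl hS
      have hle := ih (S.erase i) (Finset.erase_ssubset hi)
        fun T hT hne => h T (hT.trans (Finset.erase_subset i S)) hne
      rw [← Finset.card_erase_add_one hi, ← add_assoc] at hlt ⊢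
      rw [Finset.sum_Ioc_succ_top (Nat.le_add_right _ _), ← Finset.sum_erase_add S V hi]
      exact add_le_add hle hlt.le

theorem mem_moulinK {n : ℕ} {V : Fin n → ℝ} {k : ℕ} (hk : 1 ≤ k) {S : Finset (Fin n)}
    (hS : k ≤ S.card) (hV : ∀ i ∈ S, 1 / (k : ℝ) ≤ V i) : k ∈ moulinK V := by
  refine Finset.mem_filter.2 ⟨Finset.mem_Icc.2 ⟨hk, hS.trans ?_⟩, hS.trans (Finset.card_le_card ?_)⟩
  · simpa using S.card_le_univ
  · exact fun i hi => Finset.mem_filter.2 ⟨Finset.mem_univ i, hV i hi⟩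

theorem card_moulinA {n : ℕ} {V : Fin n → ℝ} (h : (moulinK V).Nonempty) :
    (moulinA V).card = (moulinK V).max' h := by
  have hmem := (moulinK V).max'_mem h
  obtain ⟨hIcc, hle⟩ := Finset.mem_filter.1 hmem
  have hpos := (Finset.mem_Icc.1 hIcc).1
  rw [moulinA, dif_pos h]
  refine le_antisymm (le_of_not_gt fun hlt => ?_) hle
  refine absurd ((moulinK V).le_max' _ (mem_moulinK (Nat.succ_le_succ (Nat.zero_le _)) hlt
    fun i hi => ?_)) (Nat.not_succ_le_self _)
  refine le_trans ?_ (Finset.mem_filter.1 hi).2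
  exact one_div_le_one_div_of_le (by exact_mod_cast hpos) (by exact_mod_cast Nat.le_succ _)

theorem one_div_card_le_of_mem_moulinA {n : ℕ} {V : Fin n → ℝ} {i : Fin n}
    (hi : i ∈ moulinA V) : 1 / ((moulinA V).card : ℝ) ≤ V i := by
  by_cases h : (moulinK V).Nonempty
  · rw [card_moulinA h]
    rw [moulinA, dif_pos h] at hi
    exact (Finset.mem_filter.1 hi).2
  · simp [moulinA, h] at hi

theorem le_card_moulinA {n : ℕ} {V : Fin n → ℝ} {k : ℕ} (hk : k ∈ moulinK V) :
    k ≤ (moulinA V).card := by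
  rw [card_moulinA ⟨k, hk⟩]
  exact Finset.le_max' _ k hk

theorem sum_moulinA_compl_le {n : ℕ} (V : Fin n → ℝ) :
    ∑ i ∈ (moulinA V)ᶜ, V i ≤ ∑ j ∈ Finset.Ioc (moulinA V).card n, (1 : ℝ) / j := by
  have hcard : (moulinA V).card + (moulinA V)ᶜ.card = n := by
    simp [Finset.card_add_card_compl]
  have hsum := sum_le_sum_Ioc_one_div_of_exists_lt V (moulinA V).card (moulinA V)ᶜ ?_
  · rwa [hcard] at hsum
  intro T hT hne
  by_contra! hge
  have hTpos := hne.card_pos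
  have hdisj : Disjoint (moulinA V) T := disjoint_compl_right.mono_right hT
  have hmem : (moulinA V).card + T.card ∈ moulinK V := by
    refine mem_moulinK (by lia) (Finset.card_union_of_disjoint hdisj).ge fun i hi => ?_
    rcases Finset.mem_union.1 hi with hi | hi
    · refine le_trans ?_ (one_div_card_le_of_mem_moulinA hi)
      exact one_div_le_one_div_of_le (by exact_mod_cast Finset.card_pos.2 ⟨i, hi⟩)
        (by exact_mod_cast Nat.le_add_right _ _)
    · exact hge i hi
  have := le_card_moulinA hmem
  lia

theorem sum_moulinP_le {n : ℕ} (V : Fin n → ℝ) :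
    ∑ i, moulinP V i ≤ ∑ j ∈ Finset.Ioc 0 (moulinA V).card, (1 : ℝ) / j := by
  by_cases h : (moulinK V).Nonempty
  · have hpos : 1 ≤ (moulinA V).card := by
      rw [card_moulinA h]
      exact (Finset.mem_Icc.1 (Finset.mem_filter.1 ((moulinK V).max'_mem h)).1).1
    have hsum : ∑ i, moulinP V i = 1 := by
      have hne : ((moulinA V).card : ℝ) ≠ 0 := by exact_mod_cast (by lia)
      simp only [moulinP, dif_pos h, ← card_moulinA h]
      rw [Finset.sum_ite_mem, Finset.univ_inter, Finset.sum_const, nsmul_eq_mul,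
        mul_one_div_cancel hne]
    rw [hsum]
    simpa using Finset.single_le_sum (f := fun j : ℕ => (1 : ℝ) / j)
      (fun j _ => by positivity) (Finset.mem_Ioc.2 ⟨zero_lt_one, hpos⟩)
  · simp only [moulinP, dif_neg h, Finset.sum_const_zero]
    positivity

/-- For the Moulin mechanism on `n ≥ 1` agents and every `V ≥ 0`:
`∑_{i∉A*(V)} V_i + ∑_i p_i(V) ≤ H_n`, and equivalently its dead-weight loss satisfies
`DWL(V) = (∑_{i∉A*(V)} V_i + ∑_i p_i(V) − 1)⁺ ≤ H_n − 1`, where `H_n = ∑_{j=1}^n 1/j`. -/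
theorem statement6 {n : ℕ} (hn : 1 ≤ n) (V : Fin n → ℝ) (hV : ∀ i, 0 ≤ V i) :
    (∑ i ∈ (moulinA V)ᶜ, V i + ∑ i, moulinP V i ≤ ∑ j ∈ Finset.Icc 1 n, (1 : ℝ) / j) ∧
    max (∑ i ∈ (moulinA V)ᶜ, V i + ∑ i, moulinP V i - 1) 0 ≤
      (∑ j ∈ Finset.Icc 1 n, (1 : ℝ) / j) - 1 := by
  have hbound : ∑ i ∈ (moulinA V)ᶜ, V i + ∑ i, moulinP V i ≤
      ∑ j ∈ Finset.Icc 1 n, (1 : ℝ) / j := by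
    have hsplit := Finset.sum_Ioc_consecutive (fun j : ℕ => (1 : ℝ) / j)
      (Nat.zero_le (moulinA V).card) (by simpa using (moulinA V).card_le_univ : _ ≤ n)
    have hIcc : Finset.Icc 1 n = Finset.Ioc 0 n := rfl
    rw [hIcc, ← hsplit, add_comm]
    exact add_le_add (sum_moulinP_le V) (sum_moulinA_compl_le V)
  have hone : (1 : ℝ) ≤ ∑ j ∈ Finset.Icc 1 n, (1 : ℝ) / j := by
    simpa using Finset.single_le_sum (f := fun j : ℕ => (1 : ℝ) / j)
      (fun j _ => by positivity) (Finset.mem_Icc.2 ⟨le_rfl, hn⟩)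
  exact ⟨hbound, max_le (sub_le_sub_right hbound 1) (sub_nonneg.2 hone)⟩
end

section
/- For the Moulin mechanism on n agents: if V, V' ∈ [0,∞)^n satisfy V_i ≥ V'_i for all i, then A*(V') ⊆ A*(V). -/
/-- The set `K(V)` grows with the value profile. -/
theorem moulinK_mono {n : ℕ} {V V' : Fin n → ℝ} (hle : ∀ i, V' i ≤ V i) :
    moulinK V' ⊆ moulinK V := by
  intro k hk
  simp only [moulinK, Finset.mem_filter] at hk ⊢
  refine ⟨hk.1, hk.2.trans (Finset.card_le_card fun i hi => ?_)⟩
  simp only [Finset.mem_filter, Finset.mem_univ, true_and] at hi ⊢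
  exact hi.trans (hle i)

/-- Monotonicity of the Moulin allocation rule: if `V ≥ V'`
coordinatewise (both nonnegative), then `A*(V') ⊆ A*(V)`. -/
theorem statement7 {n : ℕ} (V V' : Fin n → ℝ)
    (hV' : ∀ i, 0 ≤ V' i) (hle : ∀ i, V' i ≤ V i) :
    moulinA V' ⊆ moulinA V := by
  intro i hi
  by_cases h' : (moulinK V').Nonempty
  · have hsub := moulinK_mono hle
    have h := h'.mono hsub
    have hpos : 0 < (moulinK V').max' h' :=
      (Finset.mem_Icc.mp (Finset.mem_filter.mp (Finset.max'_mem _ h')).1).1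
    have hmax : (moulinK V').max' h' ≤ (moulinK V).max' h := Finset.max'_subset h' hsub
    simp only [moulinA, dif_pos h', Finset.mem_filter, Finset.mem_univ, true_and] at hi
    simp only [moulinA, dif_pos h, Finset.mem_filter, Finset.mem_univ, true_and]
    exact (one_div_le_one_div_of_le (Nat.cast_pos.mpr hpos) (Nat.cast_le.mpr hmax)).trans
      (hi.trans (hle i))
  · simp [moulinA, h'] at hi
end

section
/- For the Moulin mechanism on n agents: if V, V' ∈ [0,∞)^n satisfy V_i ≥ V'_i for all i, then for every agent i: V_i·1[i ∈ A*(V)] − p_i(V) ≥ V'_i·1[i ∈ A*(V')] − p_i(V'). -/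
/-- An agent's utility is the positive part of the value minus the price `1/k*(V)`. -/
theorem moulin_utility_of_nonempty {n : ℕ} (V : Fin n → ℝ) (i : Fin n)
    (h : (moulinK V).Nonempty) :
    V i * (if i ∈ moulinA V then 1 else 0) - moulinP V i =
      max 0 (V i - 1 / (((moulinK V).max' h : ℕ) : ℝ)) := by
  by_cases hi : 1 / (((moulinK V).max' h : ℕ) : ℝ) ≤ V i
  · have hA : i ∈ moulinA V := by
      rw [moulinA, dif_pos h]
      exact Finset.mem_filter.2 ⟨Finset.mem_univ i, hi⟩
    rw [moulinP, dif_pos h, if_pos hA, if_pos hA, mul_one, max_eq_right (sub_nonneg.2 hi)]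
  · have hA : i ∉ moulinA V := by
      rw [moulinA, dif_pos h]
      exact fun hm => hi (Finset.mem_filter.1 hm).2
    rw [moulinP, dif_pos h, if_neg hA, if_neg hA, mul_zero, sub_zero,
      max_eq_left (sub_nonpos.2 (not_le.1 hi).le)]

theorem moulin_utility_of_not_nonempty {n : ℕ} (V : Fin n → ℝ) (i : Fin n)
    (h : ¬ (moulinK V).Nonempty) :
    V i * (if i ∈ moulinA V then 1 else 0) - moulinP V i = 0 := by
  simp [moulinA, moulinP, h]

/-- Utility monotonicity (MT3) of the Moulin mechanism: if `V ≥ V'`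
coordinatewise (both nonnegative), then for every agent `i`,
`V_i·1[i ∈ A*(V)] − p_i(V) ≥ V'_i·1[i ∈ A*(V')] − p_i(V')`. -/
theorem statement8 {n : ℕ} (V V' : Fin n → ℝ)
    (hV' : ∀ i, 0 ≤ V' i) (hle : ∀ i, V' i ≤ V i) (i : Fin n) :
    V' i * (if i ∈ moulinA V' then 1 else 0) - moulinP V' i ≤
      V i * (if i ∈ moulinA V then 1 else 0) - moulinP V i := by
  by_cases h' : (moulinK V').Nonempty
  · have h : (moulinK V).Nonempty := h'.mono (moulinK_mono hle)
    rw [moulin_utility_of_nonempty V' i h', moulin_utility_of_nonempty V i h]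
    have hpos : 0 < (moulinK V').max' h' :=
      (Finset.mem_Icc.1 (Finset.mem_filter.1 ((moulinK V').max'_mem h')).1).1
    refine max_le_max le_rfl (sub_le_sub (hle i) ?_)
    exact one_div_le_one_div_of_le (Nat.cast_pos.2 hpos)
      (Nat.cast_le.2 (Finset.max'_subset h' (moulinK_mono hle)))
  · rw [moulin_utility_of_not_nonempty V' i h']
    by_cases h : (moulinK V).Nonempty
    · rw [moulin_utility_of_nonempty V i h]
      exact le_max_left _ _
    · rw [moulin_utility_of_not_nonempty V i h]
end

section
/- Let n ≥ 1 and let g : [0,∞)^n → [0,∞)^n be continuous, with each coordinate function g_i(β) non-increasing in β_i when the other coordinates are held fixed. Let M_1,…,M_n > 0 and η_1,…,η_n > 0, let D = [0,M_1]×⋯×[0,M_n], and assume that for all i and all β ∈ D: g_i(β_1,…,β_{i−1}, M_i, β_{i+1},…,β_n) < η_i. Then there exists β* ∈ D such that for all i: g_i(β*) = min( η_i, g_i(β*_1,…,β*_{i−1}, 0, β*_{i+1},…,β*_n) ). -/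
section Scarf

variable {I V α : Type*} [LinearOrder α]

/-- `S` is dominant for the preference profile `u` if no alternative `y` is strictly better, for
every `i`, than the `u i`-worst element of `S`. -/
def Dominant (u : I → V → α) (S : Finset V) : Prop :=
  ∀ y, ∃ i, ∀ x ∈ S, u i y ≤ u i x

/-- The alternatives that are `u l`-better than `m l` for each `l ≠ i`. -/
def BeatsOff (u : I → V → α) (m : I → V) (i : I) (y : V) : Prop :=
  ∀ l, l ≠ i → u l (m l) < u l y

theorem Dominant.mono {u : I → V → α} {S T : Finset V} (h : Dominant u S) (hTS : T ⊆ S) :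
    Dominant u T := fun y ↦ (h y).imp fun _ hi x hx ↦ hi x (hTS hx)

variable [DecidableEq V] {u : I → V → α}

theorem BeatsOff.dominant_insert {τ : Finset V} {m : I → V} (hm : ∀ i, m i ∈ τ)
    (hmin : ∀ i, ∀ x ∈ τ, u i (m i) ≤ u i x) (hτ : Dominant u τ) {i : I} {x : V}
    (hx : BeatsOff u m i x) (hmax : ∀ y, BeatsOff u m i y → u i y ≤ u i x) :
    Dominant u (insert x τ) := by
  intro y
  by_cases hy : BeatsOff u m i y
  · obtain ⟨l, hl⟩ := hτ x
    have hli : l = i := by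
      by_contra h
      exact (hx l h).not_ge (hl _ (hm l))
    subst hli
    refine ⟨l, fun z hz ↦ ?_⟩
    rcases Finset.mem_insert.1 hz with rfl | hz
    · exact hmax y hy
    · exact (hmax y hy).trans (hl z hz)
  · simp only [BeatsOff, not_forall, not_lt] at hy
    obtain ⟨l, hl, hy⟩ := hy
    refine ⟨l, fun z hz ↦ ?_⟩
    rcases Finset.mem_insert.1 hz with rfl | hz
    · exact hy.trans (hx l hl).le
    · exact hy.trans (hmin l z hz)

variable [Fintype I] [DecidableEq I]

theorem Dominant.exists_beatsOff (hu : ∀ i, Function.Injective (u i)) {τ : Finset V} {m : I → V}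
    (hm : ∀ i, m i ∈ τ) (hmin : ∀ i, ∀ x ∈ τ, u i (m i) ≤ u i x)
    (hcard : τ.card + 1 = Fintype.card I) {x : V} (hxτ : x ∉ τ)
    (hS : Dominant u (insert x τ)) :
    ∃ i, BeatsOff u m i x ∧ (∀ y, BeatsOff u m i y → u i y ≤ u i x) ∧
      ∀ l k, l ≠ i → k ≠ i → m l = m k → l = k := by
  choose p hp using hS
  have hpinj : Set.InjOn p (insert x τ : Finset V) := by
    intro a ha b hb hab
    apply hu (p a)
    refine le_antisymm (hp a b hb) ?_
    rw [hab]
    exact hp b a ha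
  have himg : (insert x τ).image p = Finset.univ := by
    rw [← Finset.card_eq_iff_eq_univ, Finset.card_image_of_injOn hpinj,
      Finset.card_insert_of_notMem hxτ, hcard]
  have key : ∀ l, l ≠ p x → p (m l) = l := by
    intro l hl
    obtain ⟨z, hz, rfl⟩ := Finset.mem_image.1 (himg ▸ Finset.mem_univ l)
    rcases Finset.mem_insert.1 hz with rfl | hzτ
    · exact absurd rfl hl
    · congr 1
      exact hu _ (le_antisymm (hmin _ z hzτ) (hp z _ (Finset.mem_insert_of_mem (hm _))))
  refine ⟨p x, fun l hl ↦ ?_, fun y hy ↦ ?_, fun l k hl hk h ↦ ?_⟩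
  · have h1 := hp (m l) x (Finset.mem_insert_self _ _)
    rw [key l hl] at h1
    refine lt_of_le_of_ne h1 fun h ↦ hxτ ?_
    rw [← hu l h]
    exact hm l
  · by_cases h : p y = p x
    · rw [← h]
      exact hp y x (Finset.mem_insert_self _ _)
    · exact absurd (hp y (m (p y)) (Finset.mem_insert_of_mem (hm _))) (hy _ h).not_ge
  · rw [← key l hl, h, key k hk]

/-- A set of `card I` coloured points missing some colour has an even number of points whose
removal leaves exactly the colours other than `i₀`. -/
theorem even_card_filter_image_erase (c : V → I) (i₀ : I) (S : Finset V)
    (hcard : S.card = Fintype.card I) (hS : S.image c ≠ Finset.univ) :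
    Even (S.filter fun x ↦ (S.erase x).image c = Finset.univ.erase i₀).card := by
  rcases (S.filter fun x ↦ (S.erase x).image c = Finset.univ.erase i₀).eq_empty_or_nonempty with
    h | ⟨x, hx⟩
  · simp [h]
  obtain ⟨hxS, hx⟩ := Finset.mem_filter.1 hx
  have hinj : Set.InjOn c (S.erase x : Finset V) := by
    rw [← Finset.card_image_iff, hx, Finset.card_erase_of_mem hxS,
      Finset.card_erase_of_mem (Finset.mem_univ _), Finset.card_univ, hcard]
  have hmem : ∀ k, k ≠ i₀ → ∃ z ∈ S, z ≠ x ∧ c z = k := fun k hk ↦ by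
    have : k ∈ (S.erase x).image c := hx ▸ Finset.mem_erase.2 ⟨hk, Finset.mem_univ _⟩
    obtain ⟨z, hz, rfl⟩ := Finset.mem_image.1 this
    exact ⟨z, Finset.mem_of_mem_erase hz, Finset.ne_of_mem_erase hz, rfl⟩
  have hcx : c x ≠ i₀ := fun h ↦ hS <| Finset.eq_univ_of_forall fun k ↦ by
    by_cases hk : k = i₀
    · exact Finset.mem_image.2 ⟨x, hxS, h.trans hk.symm⟩
    · obtain ⟨z, hz, -, rfl⟩ := hmem k hk
      exact Finset.mem_image_of_mem c hz
  have hc : ∀ z ∈ S, c z ≠ i₀ := fun z hz ↦ by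
    by_cases hzx : z = x
    · exact hzx ▸ hcx
    · have := Finset.mem_image_of_mem c (Finset.mem_erase.2 ⟨hzx, hz⟩)
      rw [hx] at this
      exact Finset.ne_of_mem_erase this
  obtain ⟨x', hx'S, hx'x, hcx'⟩ := hmem _ hcx
  suffices (S.filter fun x ↦ (S.erase x).image c = Finset.univ.erase i₀) = {x, x'} by
    rw [this, Finset.card_pair hx'x.symm]
    exact even_two
  ext y
  simp only [Finset.mem_filter, Finset.mem_insert, Finset.mem_singleton]
  constructor
  · rintro ⟨hyS, hy⟩
    by_contra! hne
    have : c y ∈ (S.erase y).image c := hy ▸ Finset.mem_erase.2 ⟨hc y hyS, Finset.mem_univ _⟩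
    obtain ⟨z, hz, hzy⟩ := Finset.mem_image.1 this
    have hyx : y ∈ (S.erase x : Finset V) := Finset.mem_erase.2 ⟨hne.1, hyS⟩
    by_cases hzx : z = x
    · refine hne.2 (hinj hyx (Finset.mem_erase.2 ⟨hx'x, hx'S⟩) ?_)
      rw [← hzy, hzx, hcx']
    · exact Finset.ne_of_mem_erase hz
        (hinj (Finset.mem_erase.2 ⟨hzx, Finset.mem_of_mem_erase hz⟩) hyx hzy)
  · rintro (rfl | rfl)
    · exact ⟨hxS, hx⟩
    · refine ⟨hx'S, Finset.ext fun k ↦ ?_⟩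
      simp only [Finset.mem_image, Finset.mem_erase, Finset.mem_univ, and_true]
      constructor
      · rintro ⟨z, ⟨-, hz⟩, rfl⟩
        exact hc z hz
      · intro hk
        obtain ⟨z, hz, hzx, rfl⟩ := hmem k hk
        by_cases hzy : z = y
        · exact ⟨x, ⟨hzy ▸ hzx.symm, hxS⟩, by rw [hzy, hcx']⟩
        · exact ⟨z, ⟨hzy, hz⟩, rfl⟩

variable [Fintype V]

open Classical in
/-- A dominant set with one element less than there are preferences extends in exactly two ways,
provided that for each `i` some alternative beats the worst elements `m l` for all `l ≠ i`. -/
theorem Dominant.card_extensions (hu : ∀ i, Function.Injective (u i)) {τ : Finset V}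
    (hτ : Dominant u τ) {m : I → V} (hm : ∀ i, m i ∈ τ)
    (hmin : ∀ i, ∀ x ∈ τ, u i (m i) ≤ u i x) (hcard : τ.card + 1 = Fintype.card I)
    (hne : ∀ i, ∃ y, BeatsOff u m i y) :
    (Finset.univ.filter fun x ↦ x ∉ τ ∧ Dominant u (insert x τ)).card = 2 := by
  have hsurj : ∀ x ∈ τ, ∃ l, m l = x := fun x hx ↦ by
    obtain ⟨l, hl⟩ := hτ x
    exact ⟨l, hu l (le_antisymm (hmin l x hx) (hl _ (hm l)))⟩
  obtain ⟨i, -, j, -, hij, hmij⟩ := Finset.exists_ne_map_eq_of_card_lt_of_maps_to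
    (s := Finset.univ) (t := τ) (f := m) (by rw [Finset.card_univ]; omega) (fun a _ ↦ hm a)
  have hmax : ∀ i, ∃ x, BeatsOff u m i x ∧ ∀ y, BeatsOff u m i y → u i y ≤ u i x := fun i ↦ by
    obtain ⟨y, hy⟩ := hne i
    obtain ⟨x, hx, hx'⟩ := Finset.exists_max_image (Finset.univ.filter (BeatsOff u m i)) (u i)
      ⟨y, by simpa using hy⟩
    exact ⟨x, by simpa using hx, fun y hy ↦ hx' y (by simpa using hy)⟩
  choose x hx hxmax using hmax
  have hnot : ∀ l k, l ≠ k → m l = m k → x l ∉ τ := by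
    intro l k hlk hm' hmem
    obtain ⟨q, hq⟩ := hsurj _ hmem
    by_cases hql : q = l
    · have := hx l k hlk.symm
      rw [← hm', ← hql, hq, hql] at this
      exact lt_irrefl _ this
    · have := hx l q hql
      rw [hq] at this
      exact lt_irrefl _ this
  rw [Finset.card_eq_two]
  refine ⟨x i, x j, fun h ↦ ?_, ?_⟩
  · obtain ⟨l, hl⟩ := hτ (x i)
    by_cases hli : l = i
    · refine (hx j l (hli ▸ hij)).not_ge ?_
      rw [← h]
      exact hl _ (hm l)
    · exact (hx i l hli).not_ge (hl _ (hm l))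
  · ext y
    simp only [Finset.mem_filter, Finset.mem_univ, true_and, Finset.mem_insert,
      Finset.mem_singleton]
    constructor
    · rintro ⟨hyτ, hy⟩
      obtain ⟨l, hl, hlmax, hlinj⟩ := hy.exists_beatsOff hu hm hmin hcard hyτ
      have hyl : y = x l := hu l (le_antisymm (hxmax l y hl) (hlmax _ (hx l)))
      by_cases hli : l = i
      · exact Or.inl (hli ▸ hyl)
      by_cases hlj : l = j
      · exact Or.inr (hlj ▸ hyl)
      exact absurd (hlinj i j (Ne.symm hli) (Ne.symm hlj) hmij) hij
    · rintro (rfl | rfl)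
      · exact ⟨hnot i j hij hmij, (hx i).dominant_insert hm hmin hτ (hxmax i)⟩
      · exact ⟨hnot j i hij.symm hmij.symm, (hx j).dominant_insert hm hmin hτ (hxmax j)⟩

open Classical in
/-- The set of all minimal alternatives `b i` with `i ≠ i₀` extends to a dominant set in exactly one
way. -/
theorem card_extensions_boundary (hu : ∀ i, Function.Injective (u i)) (b : I → V)
    (hbmin : ∀ i v, u i (b i) ≤ u i v)
    (hbmax : ∀ i j v, j ≠ i → v ∉ Set.range b → u i v < u i (b j))
    (hreal : ∃ v, v ∉ Set.range b) (i₀ : I) :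
    (Finset.univ.filter fun x ↦ x ∉ (Finset.univ.erase i₀).image b ∧
      Dominant u (insert x ((Finset.univ.erase i₀).image b))).card = 1 := by
  obtain ⟨v, hv⟩ := hreal
  obtain ⟨x₀, hx₀, hmax⟩ := Finset.exists_max_image
    (Finset.univ.filter fun v ↦ v ∉ Set.range b) (u i₀) ⟨v, by simpa using hv⟩
  replace hx₀ : x₀ ∉ Set.range b := (Finset.mem_filter.1 hx₀).2
  replace hmax : ∀ y, y ∉ Set.range b → u i₀ y ≤ u i₀ x₀ := fun y hy ↦
    hmax y (Finset.mem_filter.2 ⟨Finset.mem_univ _, hy⟩)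
  have hlt : ∀ l, u l (b l) < u l x₀ := fun l ↦
    lt_of_le_of_ne (hbmin l x₀) fun h ↦ hx₀ ⟨l, hu l h⟩
  rw [Finset.card_eq_one]
  refine ⟨x₀, Finset.ext fun x ↦ ?_⟩
  simp only [Finset.mem_filter, Finset.mem_univ, true_and, Finset.mem_singleton]
  constructor
  · rintro ⟨hx, hdom⟩
    obtain ⟨l, hl⟩ := hdom x₀
    have hli : l = i₀ := by
      by_contra h
      exact (hlt l).not_ge (hl _ (Finset.mem_insert_of_mem (Finset.mem_image_of_mem b
        (Finset.mem_erase.2 ⟨h, Finset.mem_univ _⟩))))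
    subst hli
    have hx₀x := hl x (Finset.mem_insert_self _ _)
    refine hu l (le_antisymm (hmax x ?_) hx₀x)
    rintro ⟨k, rfl⟩
    by_cases hk : k = l
    · subst hk
      exact (hlt k).not_ge hx₀x
    · exact hx (Finset.mem_image_of_mem b (Finset.mem_erase.2 ⟨hk, Finset.mem_univ _⟩))
  · rintro rfl
    refine ⟨fun h ↦ ?_, fun y ↦ ?_⟩
    · obtain ⟨k, -, hk⟩ := Finset.mem_image.1 h
      exact hx₀ ⟨k, hk⟩
    · by_cases hy : y ∈ Set.range b
      · obtain ⟨k, rfl⟩ := hy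
        exact ⟨k, fun z _ ↦ hbmin k z⟩
      · refine ⟨i₀, fun z hz ↦ ?_⟩
        rcases Finset.mem_insert.1 hz with rfl | hz
        · exact hmax y hy
        · obtain ⟨k, hk, rfl⟩ := Finset.mem_image.1 hz
          exact (hbmax i₀ k y (Finset.ne_of_mem_erase hk) hy).le

/-- **Scarf's lemma**: if each `u i` is minimal at `b i`, which the other preferences rank above all
alternatives outside the range of `b`, then a colouring giving `b i` the colour `i` admits a dominant
set on which every colour appears exactly once. -/
theorem exists_dominant_image_eq_univ [Nontrivial I] (hu : ∀ i, Function.Injective (u i))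
    (b : I → V) (hbmin : ∀ i v, u i (b i) ≤ u i v)
    (hbmax : ∀ i j v, j ≠ i → v ∉ Set.range b → u i v < u i (b j))
    (hreal : ∃ v, v ∉ Set.range b) (c : V → I) (hcb : ∀ i, c (b i) = i) :
    ∃ S : Finset V, Dominant u S ∧ S.card = Fintype.card I ∧ S.image c = Finset.univ := by
  classical
  by_contra! hno
  obtain ⟨i₀, -⟩ := exists_pair_ne I
  have hcardI : (Finset.univ.erase i₀).card + 1 = Fintype.card I := by
    rw [Finset.card_erase_add_one (Finset.mem_univ _), Finset.card_univ]
  let P : Finset (Finset V × V) := Finset.univ.filter fun p ↦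
    (p.1.card + 1 = Fintype.card I ∧ p.1.image c = Finset.univ.erase i₀) ∧
      p.2 ∉ p.1 ∧ Dominant u (insert p.2 p.1)
  have hPeven : Even P.card := by
    rw [Finset.card_eq_sum_card_fiberwise (f := fun p ↦ insert p.2 p.1) (t := Finset.univ)
      (fun _ _ ↦ Finset.mem_coe.2 (Finset.mem_univ _))]
    refine Finset.even_sum _ fun S _ ↦ ?_
    by_cases hS : Dominant u S ∧ S.card = Fintype.card I
    · suffices h : (P.filter fun p ↦ insert p.2 p.1 = S).card =
          (S.filter fun x ↦ (S.erase x).image c = Finset.univ.erase i₀).card from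
        h ▸ even_card_filter_image_erase c i₀ S hS.2 (hno S hS.1 hS.2)
      refine Finset.card_nbij' (fun p ↦ p.2) (fun x ↦ (S.erase x, x)) ?_ ?_ ?_ ?_
      · rintro ⟨τ, x⟩ h
        simp only [P, Finset.coe_filter, Finset.mem_filter, Finset.mem_univ, true_and,
          Set.mem_ofPred_eq] at h ⊢
        obtain ⟨⟨⟨h1, h2⟩, h3, h4⟩, rfl⟩ := h
        exact ⟨Finset.mem_insert_self _ _, by rwa [Finset.erase_insert h3]⟩
      · intro x h
        simp only [P, Finset.coe_filter, Finset.mem_filter, Finset.mem_univ, true_and,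
          Set.mem_ofPred_eq] at h ⊢
        refine ⟨⟨⟨?_, h.2⟩, Finset.notMem_erase _ _, ?_⟩, Finset.insert_erase h.1⟩
        · rw [Finset.card_erase_add_one h.1, hS.2]
        · rw [Finset.insert_erase h.1]
          exact hS.1
      · rintro ⟨τ, x⟩ h
        simp only [P, Finset.coe_filter, Finset.mem_filter, Finset.mem_univ, true_and,
          Set.mem_ofPred_eq] at h ⊢
        obtain ⟨⟨⟨h1, h2⟩, h3, h4⟩, rfl⟩ := h
        rw [Finset.erase_insert h3]
      · intro x _
        rfl
    · convert Even.zero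
      rw [Finset.card_eq_zero, Finset.filter_eq_empty_iff]
      rintro ⟨τ, x⟩ h rfl
      simp only [P, Finset.mem_filter, Finset.mem_univ, true_and] at h
      exact hS ⟨h.2.2, by rw [Finset.card_insert_of_notMem h.2.1, h.1.1]⟩
  have hfiber : ∀ τ : Finset V, τ.card + 1 = Fintype.card I →
      τ.image c = Finset.univ.erase i₀ →
      (P.filter fun p ↦ p.1 = τ).card =
        (Finset.univ.filter fun x ↦ x ∉ τ ∧ Dominant u (insert x τ)).card := by
    intro τ h1 h2
    refine Finset.card_nbij' (fun p ↦ p.2) (fun x ↦ (τ, x)) ?_ ?_ ?_ ?_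
    · rintro ⟨τ', x⟩ h
      simp only [P, Finset.coe_filter, Finset.mem_filter, Finset.mem_univ, true_and,
        Set.mem_ofPred_eq] at h ⊢
      obtain ⟨h, rfl⟩ := h
      exact h.2
    · intro x h
      simp only [P, Finset.coe_filter, Finset.mem_filter, Finset.mem_univ, true_and,
        Set.mem_ofPred_eq] at h ⊢
      exact ⟨⟨⟨h1, h2⟩, h⟩, trivial⟩
    · rintro ⟨τ', x⟩ h
      simp only [Finset.coe_filter, Set.mem_ofPred_eq] at h
      rw [h.2]
    · intro x _
      rfl
  have hbinj : Function.Injective b := Function.LeftInverse.injective hcb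
  have hPodd : Odd P.card := by
    let τ₀ : Finset V := (Finset.univ.erase i₀).image b
    rw [Finset.card_eq_sum_card_fiberwise (f := fun p ↦ p.1) (t := Finset.univ)
      (fun _ _ ↦ Finset.mem_coe.2 (Finset.mem_univ _)),
      ← Finset.add_sum_erase _ _ (Finset.mem_univ τ₀)]
    refine Odd.add_even ?_ (Finset.even_sum _ fun τ hτ ↦ ?_)
    · rw [hfiber τ₀, card_extensions_boundary hu b hbmin hbmax hreal i₀]
      · exact odd_one
      · rw [Finset.card_image_of_injective _ hbinj, hcardI]
      · simp [τ₀, Finset.image_image, Function.comp_def, hcb]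
    · rcases (P.filter fun p ↦ p.1 = τ).eq_empty_or_nonempty with h | ⟨⟨τ', x⟩, hx⟩
      · simp [h]
      simp only [P, Finset.mem_filter, Finset.mem_univ, true_and] at hx
      obtain ⟨⟨⟨h1, h2⟩, h3, h4⟩, rfl⟩ := hx
      have hne : τ'.Nonempty := by
        rw [← Finset.card_pos]
        have := Fintype.one_lt_card (α := I)
        omega
      have hv : ∃ v ∈ τ', v ∉ Set.range b := by
        by_contra! hall
        refine Finset.ne_of_mem_erase hτ (Finset.ext fun v ↦ ?_)
        constructor
        · intro hv
          obtain ⟨k, rfl⟩ := hall v hv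
          have := Finset.mem_image_of_mem c hv
          rw [h2, hcb] at this
          exact Finset.mem_image_of_mem b this
        · intro hv
          obtain ⟨k, hk, rfl⟩ := Finset.mem_image.1 hv
          rw [← h2] at hk
          obtain ⟨w, hw, rfl⟩ := Finset.mem_image.1 hk
          obtain ⟨l, rfl⟩ := hall w hw
          rwa [hcb]
      obtain ⟨v, hvτ, hv⟩ := hv
      have hmin : ∀ i, ∃ m ∈ τ', ∀ x ∈ τ', u i m ≤ u i x := fun i ↦
        Finset.exists_min_image τ' (u i) hne
      choose m hm hmin using hmin
      rw [hfiber _ h1 h2, (h4.mono (Finset.subset_insert _ _)).card_extensions hu hm hmin h1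
        fun i ↦ ⟨b i, fun l hl ↦ (hmin l v hvτ).trans_lt (hbmax l i v hl.symm hv)⟩]
      exact even_two
  exact Nat.not_even_iff_odd.2 hPodd hPeven

end Scarf

section Brouwer

open Finset

variable {I : Type*} [Fintype I]

/-- For every colouring of the grid `∑ i, z i = k`, some grid point `z` has, for each `i`, either
a small coordinate `z i` or a nearby grid point of colour `i`. -/
theorem exists_grid_colouring [Nontrivial I] (k : ℕ) (c : (I → ℕ) → I) :
    ∃ z : I → ℕ, ∑ i, z i = k ∧ ∀ i, z i ≤ Fintype.card I ∨
      ∃ w : I → ℕ, ∑ j, w j = k ∧ c w = i ∧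
        ∀ j, w j ≤ z j + Fintype.card I ∧ z j ≤ w j + Fintype.card I := by
  classical
  let T := {x : I → ℕ // x ∈ piAntidiag univ k}
  have : Fintype T := Finset.fintypeCoeSort (piAntidiag univ k)
  have hTsum : ∀ x : T, ∑ i, x.1 i = k := fun x ↦ (mem_piAntidiag.1 x.2).1
  let e := Fintype.equivFin (T ⊕ I)
  let val : T ⊕ I → I → ℕ := Sum.elim (fun x i ↦ x.1 i + 1) fun j i ↦ if j = i then 0 else k + 2
  let u : I → T ⊕ I → ℕ ×ₗ Fin (Fintype.card (T ⊕ I)) := fun i v ↦ toLex (val v i, e v)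
  have hult : ∀ i v w, val v i < val w i → u i v < u i w := fun i v w h ↦
    Prod.Lex.toLex_lt_toLex.2 (Or.inl h)
  have hule : ∀ i v w, u i v ≤ u i w → val v i ≤ val w i := fun i v w h ↦ by
    by_contra! h'
    exact (hult i w v h').not_ge h
  have hu : ∀ i, Function.Injective (u i) := fun i v w h ↦ by
    have := congrArg (fun p ↦ (ofLex p).2) h
    exact e.injective this
  obtain ⟨i₁⟩ : Nonempty I := inferInstance
  have hmk : ∀ x : I → ℕ, ∑ i, x i = k → x ∈ piAntidiag univ k := fun x hx ↦
    mem_piAntidiag.2 ⟨hx, fun _ _ ↦ mem_univ _⟩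
  have hle : ∀ (x : T) i, x.1 i ≤ k := fun x i ↦
    (single_le_sum (f := x.1) (fun _ _ ↦ Nat.zero_le _) (mem_univ i)).trans (hTsum x).le
  let t₀ : T := ⟨Pi.single i₁ k, hmk _ (by simp)⟩
  obtain ⟨S, hS, -, hSc⟩ := exists_dominant_image_eq_univ (u := u) hu Sum.inr
    (fun i v ↦ by
      by_cases h : v = Sum.inr i
      · rw [h]
      · refine (hult i _ _ ?_).le
        rcases v with x | j
        · simp [val]
        · have : j ≠ i := fun h' ↦ h (h' ▸ rfl)
          simp [val, this])
    (fun i j v hji hv ↦ by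
      rcases v with x | l
      · refine hult i _ _ ?_
        have := hle x i
        simp only [val, Sum.elim_inl, Sum.elim_inr, if_neg hji]
        omega
      · exact absurd ⟨l, rfl⟩ hv)
    ⟨Sum.inl t₀, by simp⟩ (Sum.elim (fun x ↦ c x.1) id) (fun _ ↦ rfl)
  let C : Finset I := univ.filter fun i ↦ Sum.inr i ∉ S
  have hdom : ∀ y : T, ∃ i ∈ C, ∀ x : T, Sum.inl x ∈ S → y.1 i ≤ x.1 i := by
    intro y
    obtain ⟨i, hi⟩ := hS (Sum.inl y)
    refine ⟨i, mem_filter.2 ⟨mem_univ _, fun h ↦ ?_⟩, fun x hx ↦ ?_⟩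
    · simpa [val] using hule i _ _ (hi _ h)
    · simpa [val] using hule i _ _ (hi _ hx)
  have hcol : ∀ i ∈ C, ∃ w : T, Sum.inl w ∈ S ∧ c w.1 = i := by
    intro i hi
    have : i ∈ S.image (Sum.elim (fun x : T ↦ c x.1) id) := by
      rw [hSc]
      exact mem_univ i
    obtain ⟨w | j, hw, hwi⟩ := mem_image.1 this
    · exact ⟨w, hw, hwi⟩
    · simp only [Sum.elim_inr, id] at hwi
      exact absurd (hwi ▸ hw) (mem_filter.1 hi).2
  obtain ⟨i₂, hi₂, -⟩ := hdom t₀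
  obtain ⟨z, hzS, -⟩ := hcol i₂ hi₂
  have hmin : ∀ i, ∃ a : ℕ, (∀ x : T, Sum.inl x ∈ S → a ≤ x.1 i) ∧
      ∃ x : T, Sum.inl x ∈ S ∧ x.1 i = a := fun i ↦ by
    obtain ⟨x, hx, hx'⟩ := exists_min_image (univ.filter fun x : T ↦ Sum.inl x ∈ S)
      (fun x ↦ x.1 i) ⟨z, by simpa using hzS⟩
    exact ⟨x.1 i, fun y hy ↦ hx' y (by simpa using hy), x, by simpa using hx, rfl⟩
  choose a ha x hxS hxa using hmin
  have hsum : k < ∑ i ∈ C, (a i + 1) := by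
    by_contra! h
    let y : I → ℕ := fun i ↦ (if i ∈ C then a i + 1 else 0) +
      if i = i₂ then k - ∑ i ∈ C, (a i + 1) else 0
    have hy : ∑ i, y i = k := by
      simp only [y, sum_add_distrib, sum_ite_mem, univ_inter, sum_ite_eq', mem_univ, if_true]
      rw [← sum_add_distrib]
      omega
    obtain ⟨i, hi, hi'⟩ := hdom ⟨y, hmk y hy⟩
    have h1 := hi' (x i) (hxS i)
    have h2 : a i + 1 ≤ y i := by simp [y, hi]
    rw [hxa] at h1
    exact absurd (h2.trans h1) (by omega)
  have hbd : ∀ w : T, Sum.inl w ∈ S → ∀ j,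
      (j ∈ C → w.1 j ≤ a j + Fintype.card I) ∧ (j ∉ C → w.1 j ≤ Fintype.card I) := by
    intro w hw j
    have hC : C.card ≤ Fintype.card I := card_le_univ C
    rw [sum_add_distrib, sum_const, smul_eq_mul, mul_one] at hsum
    have hw' := hTsum w
    constructor
    · intro hj
      have h1 : ∑ i ∈ C, w.1 i ≤ ∑ i, w.1 i := sum_le_sum_of_subset (subset_univ C)
      have h2 : ∑ i ∈ C.erase j, a i ≤ ∑ i ∈ C.erase j, w.1 i := sum_le_sum fun i _ ↦ ha i w hw
      rw [← add_sum_erase _ _ hj] at h1 hsum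
      omega
    · intro hj
      have h1 : ∑ i ∈ insert j C, w.1 i ≤ ∑ i, w.1 i := sum_le_sum_of_subset (subset_univ _)
      have h2 : ∑ i ∈ C, a i ≤ ∑ i ∈ C, w.1 i := sum_le_sum fun i _ ↦ ha i w hw
      rw [sum_insert hj] at h1
      omega
  refine ⟨z.1, hTsum z, fun i ↦ ?_⟩
  by_cases hi : i ∈ C
  · obtain ⟨w, hwS, hwi⟩ := hcol i hi
    refine Or.inr ⟨w.1, hTsum w, hwi, fun j ↦ ?_⟩
    have h1 := hbd w hwS j
    have h2 := hbd z hzS j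
    have h3 := ha j w hwS
    have h4 := ha j z hzS
    by_cases hj : j ∈ C
    · have := h1.1 hj
      have := h2.1 hj
      omega
    · have := h1.2 hj
      have := h2.2 hj
      omega
  · exact Or.inl ((hbd z hzS i).2 hi)

theorem exists_approx_fixedPoint_stdSimplex [Nontrivial I] {f : (I → ℝ) → I → ℝ}
    (hf : ContinuousOn f (stdSimplex ℝ I)) (hmaps : Set.MapsTo f (stdSimplex ℝ I) (stdSimplex ℝ I))
    {ε : ℝ} (hε : 0 < ε) : ∃ z ∈ stdSimplex ℝ I, ∀ i, z i - ε ≤ f z i := by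
  classical
  have huc := (isCompact_stdSimplex ℝ I).uniformContinuousOn_of_continuous hf
  obtain ⟨δ, hδ, huc⟩ := Metric.uniformContinuousOn_iff.1 huc (ε / 2) (by positivity)
  obtain ⟨k, hk⟩ := exists_nat_gt ((Fintype.card I : ℝ) / min δ (ε / 2))
  have hmin : 0 < min δ (ε / 2) := by positivity
  have hk0 : (0 : ℝ) < k := lt_of_le_of_lt (by positivity) hk
  have hkc : (Fintype.card I : ℝ) / k < min δ (ε / 2) := by
    rw [div_lt_iff₀ hmin] at hk
    rw [div_lt_iff₀ hk0]
    linarith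
  let p : (I → ℕ) → I → ℝ := fun x i ↦ x i / k
  have hp : ∀ x : I → ℕ, ∑ i, x i = k → p x ∈ stdSimplex ℝ I := fun x hx ↦ by
    refine ⟨fun i ↦ by positivity, ?_⟩
    simp only [p]
    rw [← sum_div, ← Nat.cast_sum, hx, div_self hk0.ne']
  have hc : ∀ x : I → ℕ, ∃ i, ∑ i, x i = k → p x i ≤ f (p x) i := fun x ↦ by
    by_cases hx : ∑ i, x i = k
    · have h : ∑ i, p x i ≤ ∑ i, f (p x) i := by
        rw [(hp x hx).2, (hmaps (hp x hx)).2]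
      obtain ⟨i, -, hi⟩ := exists_le_of_sum_le univ_nonempty h
      exact ⟨i, fun _ ↦ hi⟩
    · exact ⟨Classical.arbitrary I, fun h ↦ absurd h hx⟩
  choose c hc using hc
  obtain ⟨z, hz, hzc⟩ := exists_grid_colouring k c
  refine ⟨p z, hp z hz, fun i ↦ ?_⟩
  rcases hzc i with hi | ⟨w, hw, rfl, hwz⟩
  · have h1 : p z i ≤ Fintype.card I / k := by
      simp only [p]
      gcongr
    have h2 := (hmaps (hp z hz)).1 i
    have h3 := min_le_right δ (ε / 2)
    linarith
  · have hd : ∀ j, |p w j - p z j| ≤ Fintype.card I / k := fun j ↦ by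
      have h1 : (w j : ℝ) ≤ z j + Fintype.card I := by exact_mod_cast (hwz j).1
      have h2 : (z j : ℝ) ≤ w j + Fintype.card I := by exact_mod_cast (hwz j).2
      simp only [p]
      rw [← sub_div, abs_div, abs_of_pos hk0]
      gcongr
      rw [abs_le]
      constructor <;> linarith
    have hdist : dist (p w) (p z) < δ :=
      ((dist_pi_le_iff (by positivity)).2 hd).trans_lt (hkc.trans_le (min_le_left _ _))
    have h1 := (dist_le_pi_dist _ _ (c w)).trans_lt (huc _ (hp w hw) _ (hp z hz) hdist)
    rw [Real.dist_eq, abs_lt] at h1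
    have h2 := abs_le.1 (hd (c w))
    have h3 := hc w hw
    have h4 := min_le_right δ (ε / 2)
    linarith

/-- **Brouwer's fixed-point theorem** on the standard simplex. -/
theorem exists_fixedPoint_stdSimplex [Nontrivial I] {f : (I → ℝ) → I → ℝ}
    (hf : ContinuousOn f (stdSimplex ℝ I))
    (hmaps : Set.MapsTo f (stdSimplex ℝ I) (stdSimplex ℝ I)) :
    ∃ z ∈ stdSimplex ℝ I, f z = z := by
  classical
  have hcont : ContinuousOn (fun z ↦ ∑ i, max 0 (z i - f z i)) (stdSimplex ℝ I) := by
    fun_prop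
  obtain ⟨z, hz, hzmin⟩ := (isCompact_stdSimplex ℝ I).exists_isMinOn
    ⟨_, single_mem_stdSimplex ℝ (Classical.arbitrary I)⟩ hcont
  refine ⟨z, hz, ?_⟩
  have hle : ∑ i, max 0 (z i - f z i) ≤ 0 := by
    refine le_of_forall_pos_le_add fun ε hε ↦ ?_
    have hcard : (0 : ℝ) < Fintype.card I := by exact_mod_cast Fintype.card_pos
    obtain ⟨y, hy, hyε⟩ := exists_approx_fixedPoint_stdSimplex hf hmaps (div_pos hε hcard)
    calc ∑ i, max 0 (z i - f z i) ≤ ∑ i, max 0 (y i - f y i) := hzmin hy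
      _ ≤ ∑ _i : I, ε / Fintype.card I := sum_le_sum fun i _ ↦
          max_le (div_pos hε hcard).le (by linarith [hyε i])
      _ = 0 + ε := by
          rw [sum_const, card_univ, nsmul_eq_mul]
          field_simp
          ring
  have hzf : ∀ i, z i ≤ f z i := fun i ↦ by
    have := single_le_sum (f := fun i ↦ max 0 (z i - f z i)) (fun _ _ ↦ le_max_left _ _)
      (mem_univ i)
    linarith [le_max_right 0 (z i - f z i)]
  have hsum : ∑ i, z i = ∑ i, f z i := by rw [hz.2, (hmaps hz).2]
  funext i
  exact ((sum_eq_sum_iff_of_le fun i _ ↦ hzf i).1 hsum i (mem_univ i)).symm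

/-- **Brouwer's fixed-point theorem** on a box. -/
theorem exists_fixedPoint_Icc [Nonempty I] {M : I → ℝ} (hM : ∀ i, 0 < M i)
    {F : (I → ℝ) → I → ℝ} (hF : ContinuousOn F (Set.Icc 0 M))
    (hmaps : Set.MapsTo F (Set.Icc 0 M) (Set.Icc 0 M)) :
    ∃ β ∈ Set.Icc 0 M, F β = β := by
  classical
  have hS : 0 < ∑ i, M i := sum_pos (fun i _ ↦ hM i) univ_nonempty
  set s := ∑ i, M i
  let r : (Option I → ℝ) → I → ℝ := fun x i ↦ min (s * x (some i)) (M i)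
  have hr : Set.MapsTo r (stdSimplex ℝ (Option I)) (Set.Icc 0 M) := fun x hx ↦
    ⟨fun i ↦ le_min (mul_nonneg hS.le (hx.1 _)) (hM i).le, fun i ↦ min_le_right _ _⟩
  let G : (Option I → ℝ) → Option I → ℝ := fun x o ↦
    o.elim (1 - ∑ i, F (r x) i / s) fun i ↦ F (r x) i / s
  have hFr : ContinuousOn (fun x ↦ F (r x)) (stdSimplex ℝ (Option I)) :=
    hF.comp (by fun_prop) hr
  have hG : ContinuousOn G (stdSimplex ℝ (Option I)) := by
    refine continuousOn_pi.2 fun o ↦ ?_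
    rcases o with _ | i
    · exact continuousOn_const.sub
        (continuousOn_finsetSum _ fun i _ ↦ (continuousOn_pi.1 hFr i).div_const s)
    · exact (continuousOn_pi.1 hFr i).div_const s
  have hGmaps : Set.MapsTo G (stdSimplex ℝ (Option I)) (stdSimplex ℝ (Option I)) := by
    intro x hx
    have hFx := hmaps (hr hx)
    refine ⟨fun o ↦ ?_, by simp [G, Fintype.sum_option]⟩
    rcases o with _ | i
    · simp only [G, Option.elim_none]
      rw [← sum_div, sub_nonneg, div_le_one hS]
      exact sum_le_sum fun i _ ↦ hFx.2 i
    · exact div_nonneg (hFx.1 i) hS.le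
  obtain ⟨x, hx, hGx⟩ := exists_fixedPoint_stdSimplex hG hGmaps
  have hxF : ∀ i, s * x (some i) = F (r x) i := fun i ↦ by
    have h : F (r x) i / s = x (some i) := congrFun hGx (some i)
    rw [← h]
    field_simp
  refine ⟨r x, hr hx, funext fun i ↦ ?_⟩
  simp only [r]
  rw [hxF i]
  exact (min_eq_left ((hmaps (hr hx)).2 i)).symm

/-- **Poincaré–Miranda theorem**. -/
theorem exists_zero_of_sign_on_faces [Nonempty I] {M : I → ℝ} (hM : ∀ i, 0 < M i)
    {h : (I → ℝ) → I → ℝ} (hh : ContinuousOn h (Set.Icc 0 M))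
    (h0 : ∀ β ∈ Set.Icc 0 M, ∀ i, β i = 0 → h β i ≤ 0)
    (h1 : ∀ β ∈ Set.Icc 0 M, ∀ i, β i = M i → 0 ≤ h β i) :
    ∃ β ∈ Set.Icc 0 M, h β = 0 := by
  obtain ⟨β, hβ, hfix⟩ := exists_fixedPoint_Icc hM
    (F := fun β i ↦ max 0 (min (M i) (β i - h β i))) (by fun_prop)
    (fun β _ ↦ ⟨fun i ↦ le_max_left _ _, fun i ↦ max_le (hM i).le (min_le_left _ _)⟩)
  refine ⟨β, hβ, funext fun i ↦ ?_⟩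
  have hi : max 0 (min (M i) (β i - h β i)) = β i := congrFun hfix i
  have hMi := hM i
  have h0i := h0 β hβ i
  have h1i := h1 β hβ i
  simp only [Pi.zero_apply]
  grind

end Brouwer

/-- Fixed-point lemma: if `g : [0,∞)^n → [0,∞)^n` is continuous with
each `g_i` non-increasing in `β_i`, `M_i, η_i > 0`, `D = [0,M_1]×⋯×[0,M_n]`, and
`g_i(β_{-i}, M_i) < η_i` for all `i` and `β ∈ D`, then there is `β* ∈ D` with
`g_i(β*) = min(η_i, g_i(β*_{-i}, 0))` for all `i`. -/
theorem statement9 {n : ℕ} (hn : 1 ≤ n) (g : (Fin n → ℝ) → Fin n → ℝ)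
    (hgcont : ContinuousOn g {β : Fin n → ℝ | ∀ i, 0 ≤ β i})
    (hgnonneg : ∀ β : Fin n → ℝ, (∀ i, 0 ≤ β i) → ∀ i, 0 ≤ g β i)
    (hgmono : ∀ (i : Fin n) (β : Fin n → ℝ), (∀ j, 0 ≤ β j) →
      ∀ s t : ℝ, 0 ≤ s → s ≤ t →
        g (Function.update β i t) i ≤ g (Function.update β i s) i)
    (M η : Fin n → ℝ) (hM : ∀ i, 0 < M i) (hη : ∀ i, 0 < η i)
    (hbound : ∀ i : Fin n, ∀ β ∈ Set.Icc (0 : Fin n → ℝ) M,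
      g (Function.update β i (M i)) i < η i) :
    ∃ β ∈ Set.Icc (0 : Fin n → ℝ) M,
      ∀ i, g β i = min (η i) (g (Function.update β i 0) i) := by
  have : Nonempty (Fin n) := ⟨⟨0, hn⟩⟩
  have hsub : Set.Icc (0 : Fin n → ℝ) M ⊆ {β : Fin n → ℝ | ∀ i, 0 ≤ β i} := fun β hβ ↦ hβ.1
  have hcont0 : ∀ i, ContinuousOn (fun β ↦ g (Function.update β i 0)) (Set.Icc 0 M) := fun i ↦
    hgcont.comp (by fun_prop) fun β hβ j ↦ by
      rcases eq_or_ne j i with rfl | h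
      · simp
      · simpa [h] using hβ.1 j
  have hcont := hgcont.mono hsub
  obtain ⟨β, hβ, hzero⟩ := exists_zero_of_sign_on_faces hM
    (h := fun β i ↦ min (η i) (g (Function.update β i 0) i) - g β i)
    (continuousOn_pi.2 fun i ↦
      (continuousOn_const.inf (continuousOn_pi.1 (hcont0 i) i)).sub (continuousOn_pi.1 hcont i))
    (fun β _ i hi ↦ by
      have h : Function.update β i 0 = β := by rw [← hi, Function.update_eq_self]
      simp only [h, sub_nonpos]
      exact min_le_right _ _)
    (fun β hβ i hi ↦ by
      have h : Function.update β i (M i) = β := by rw [← hi, Function.update_eq_self]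
      have hlt := hbound i β hβ
      have hle := hgmono i β hβ.1 0 (M i) le_rfl (hM i).le
      rw [h] at hlt hle
      exact sub_nonneg.2 (le_min hlt.le hle))
  exact ⟨β, hβ, fun i ↦ (sub_eq_zero.1 (congrFun hzero i)).symm⟩
end

section
/- Let 𝒟 be a probability measure on [0,1]^n that is absolutely continuous with respect to Lebesgue measure, and let S ⊆ {1,…,n} be nonempty. Let A ⊆ [0,1]^n be measurable, and suppose A is Pareto-optimal with respect to S: there is no measurable g : [0,1]^n → [0,1] such that ∫ g d𝒟 ≤ 𝒟(A), ∫ x_i·g(x) d𝒟(x) ≥ ∫_A x_i d𝒟(x) for all i ∈ S, with the latter inequality strict for some i ∈ S. Then there exist β_i ≥ 0 (i ∈ S) with Σ_{i∈S} β_i = 1 and z ≥ 0 such that 𝒟( A Δ {x ∈ [0,1]^n : Σ_{i∈S} β_i x_i ≥ z} ) = 0, where Δ denotes symmetric difference. -/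
open MeasureTheory

/-- A convex set in a finite-dimensional coordinate space that misses the open positive orthant
lies in a half-space with nonzero nonnegative normal vector. -/
theorem exists_nonneg_weights_of_convex {ι : Type*} [Fintype ι] {K : Set (ι → ℝ)}
    (hK : Convex ℝ K) (hpos : ∀ k ∈ K, ¬ ∀ i, 0 < k i) (hne : K.Nonempty) :
    ∃ w : ι → ℝ, (∀ i, 0 ≤ w i) ∧ w ≠ 0 ∧ ∀ k ∈ K, ∑ i, w i * k i ≤ 0 := by
  classical
  have hP : {d : ι → ℝ | ∀ i, 0 < d i} = Set.univ.pi fun _ => Set.Ioi 0 := by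
    ext d; simp
  obtain ⟨f, s, hD, hKs⟩ := geometric_hahn_banach_open
    (s := {d : ι → ℝ | ∀ i, 0 < d i}) (t := K)
    (hP ▸ convex_pi fun _ _ => convex_Ioi 0)
    (hP ▸ isOpen_set_pi Set.finite_univ fun _ _ => isOpen_Ioi) hK
    (Set.disjoint_left.2 fun d hd hdK => hpos d hdK hd)
  have hle : ∀ d : ι → ℝ, (∀ i, 0 ≤ d i) → f d ≤ s := by
    intro d hd
    have hlim : Filter.Tendsto (fun t : ℝ => f (d + t • 1)) (nhdsWithin 0 (Set.Ioi 0))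
        (nhds (f (d + (0 : ℝ) • 1))) :=
      (Continuous.tendsto (by fun_prop) 0).mono_left nhdsWithin_le_nhds
    rw [zero_smul, add_zero] at hlim
    refine le_of_tendsto hlim ?_
    filter_upwards [self_mem_nhdsWithin] with t ht
    refine (hD _ fun i => ?_).le
    have := hd i
    have ht' : 0 < t := ht
    simp only [Pi.add_apply, Pi.smul_apply, Pi.one_apply, smul_eq_mul]
    linarith
  have hs : 0 ≤ s := by simpa using hle 0 fun _ => le_rfl
  have hf : ∀ k : ι → ℝ, f k = ∑ i, f (Pi.single i 1) * k i := by
    intro k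
    conv_lhs => rw [pi_eq_sum_univ' k]
    simp [map_sum, mul_comm]
  refine ⟨fun i => -f (Pi.single i 1), fun i => ?_, fun h0 => ?_, fun k hk => ?_⟩
  · by_contra! hi
    have hi' : 0 < f (Pi.single i 1) := by linarith
    have h := hle (((s + 1) / f (Pi.single i 1)) • Pi.single i 1) fun j => by
      have : (0 : ℝ) ≤ (Pi.single i 1 : ι → ℝ) j :=
        by
        rw [Pi.single_apply]; split_ifs <;> simp
      simp only [Pi.smul_apply, smul_eq_mul]
      positivity
    rw [map_smul, smul_eq_mul, div_mul_cancel₀ _ hi'.ne'] at h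
    linarith
  · have hz : ∀ k, f k = 0 := fun k => by
      rw [hf]
      exact Finset.sum_eq_zero fun i _ => by
        have : f (Pi.single i 1) = 0 := by simpa using congrFun h0 i
        rw [this, zero_mul]
    obtain ⟨k, hk⟩ := hne
    have h1 := hD 1 fun _ => one_pos
    have h2 := hKs k hk
    rw [hz] at h1 h2
    linarith
  · have h := hKs k hk
    rw [hf] at h
    simp only [neg_mul, Finset.sum_neg_distrib]
    linarith

/-- A hyperplane with nonzero normal vector is Lebesgue null. -/
theorem volume_hyperplane_eq_zero {ι : Type*} [Fintype ι] (S : Finset ι) (l : ι → ℝ)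
    {j : ι} (hj : j ∈ S) (hl : l j ≠ 0) (c : ℝ) :
    volume {x : ι → ℝ | ∑ i ∈ S, l i * x i = c} = 0 := by
  classical
  let L : (ι → ℝ) →ₗ[ℝ] ℝ := ∑ i ∈ S, l i • LinearMap.proj i
  have hL : ∀ x, L x = ∑ i ∈ S, l i * x i := fun x => by simp [L, LinearMap.sum_apply]
  have hLj : L (Pi.single j 1) = l j := by simp [hL, Pi.single_apply, hj]
  let H : AffineSubspace ℝ (ι → ℝ) := (AffineSubspace.mk' c ⊥).comap L.toAffineMap
  have hH : {x : ι → ℝ | ∑ i ∈ S, l i * x i = c} = H := by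
    ext x
    simp [H, hL, sub_eq_zero]
  rw [hH]
  refine Measure.addHaar_affineSubspace _ _ fun htop => ?_
  have hmem : ∀ x : ι → ℝ, L x = c := fun x => by
    have : x ∈ (H : Set (ι → ℝ)) := by rw [htop]; trivial
    rw [← hH] at this
    rw [hL]; exact this
  have h0 := hmem 0
  rw [map_zero] at h0
  exact hl (by rw [← hLj, hmem, h0])

/-- A set maximizing `∫ h` agrees almost everywhere with `{0 ≤ h}` when `h` has null zero set. -/
theorem ae_eq_superlevel_of_setIntegral_le {α : Type*} [MeasurableSpace α] {μ : Measure α}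
    {h : α → ℝ} (hh : Integrable h μ) {A H : Set α} (hA : MeasurableSet A) (hH : MeasurableSet H)
    (hHh : ∀ᵐ x ∂μ, x ∈ H ↔ 0 ≤ h x) (h0 : ∀ᵐ x ∂μ, h x ≠ 0)
    (hle : ∫ x in H, h x ∂μ ≤ ∫ x in A, h x ∂μ) : μ (symmDiff A H) = 0 := by
  rw [← integral_indicator hA, ← integral_indicator hH] at hle
  have hi := (hh.indicator hH).sub (hh.indicator hA)
  have hnn : 0 ≤ᵐ[μ] H.indicator h - A.indicator h := by
    filter_upwards [hHh] with x hx
    by_cases h1 : x ∈ H <;> by_cases h2 : x ∈ A <;> simp [h1, h2] <;> grind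
  have hz : ∫ x, (H.indicator h - A.indicator h) x ∂μ = 0 := by
    refine le_antisymm ?_ (integral_nonneg_of_ae hnn)
    simp only [Pi.sub_apply]
    rw [integral_sub (hh.indicator hH) (hh.indicator hA)]
    linarith
  rw [integral_eq_zero_iff_of_nonneg_ae hnn hi] at hz
  have : ∀ᵐ x ∂μ, x ∉ symmDiff A H := by
    filter_upwards [hz, h0] with x hx hx0
    rw [Set.mem_symmDiff]
    by_cases h1 : x ∈ H <;> by_cases h2 : x ∈ A <;> simp_all
  simpa [ae_iff] using this

/-- A Pareto-optimal allocation maximizes some nontrivial nonnegative combination of the agents'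
utilities and the negated cost. -/
theorem exists_weights_of_paretoOptimal {α ι : Type*} [MeasurableSpace α] {μ : Measure α}
    [IsFiniteMeasure μ] (S : Finset ι) (hS : S.Nonempty) (u : ι → α → ℝ)
    (hu : ∀ i, Integrable (u i) μ) {A : Set α}
    (hpareto : ¬ ∃ g : α → ℝ, Measurable g ∧
      (∀ x, g x ∈ Set.Icc (0 : ℝ) 1) ∧
      (∫ x, g x ∂μ ≤ (μ A).toReal) ∧
      (∀ i ∈ S, ∫ x in A, u i x ∂μ ≤ ∫ x, u i x * g x ∂μ) ∧
      (∃ i ∈ S, ∫ x in A, u i x ∂μ < ∫ x, u i x * g x ∂μ)) :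
    ∃ (l : ι → ℝ) (c : ℝ), (∀ i ∈ S, 0 ≤ l i) ∧ 0 ≤ c ∧ (c = 0 → ∃ i ∈ S, l i ≠ 0) ∧
      ∀ B, MeasurableSet B →
        ∫ x in B, (∑ i ∈ S, l i * u i x - c) ∂μ ≤ ∫ x in A, (∑ i ∈ S, l i * u i x - c) ∂μ := by
  classical
  let v : (α → ℝ) → Option S → ℝ := fun g o => o.elim ((μ A).toReal - ∫ x, g x ∂μ)
    fun i => ∫ x, u i x * g x ∂μ - ∫ x in A, u i x ∂μ
  let G : Set (α → ℝ) := {g | Measurable g ∧ ∀ x, g x ∈ Set.Icc (0 : ℝ) 1}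
  have hbd : ∀ g ∈ G, ∀ᵐ x ∂μ, ‖g x‖ ≤ 1 := fun g hg => ae_of_all _ fun x => by
    rw [Real.norm_eq_abs, abs_of_nonneg (hg.2 x).1]; exact (hg.2 x).2
  have hint : ∀ g ∈ G, Integrable g μ := fun g hg =>
    Integrable.of_bound hg.1.aestronglyMeasurable 1 (hbd g hg)
  have hintu : ∀ g ∈ G, ∀ i, Integrable (fun x => u i x * g x) μ := fun g hg i =>
    (hu i).mul_bdd hg.1.aestronglyMeasurable (hbd g hg)
  have hconv : Convex ℝ (v '' G) := by
    rintro _ ⟨g, hg, rfl⟩ _ ⟨k, hk, rfl⟩ a b ha hb hab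
    refine ⟨a • g + b • k, ⟨(hg.1.const_smul a).add (hk.1.const_smul b), fun x => ?_⟩, ?_⟩
    · exact (convex_Icc (0 : ℝ) 1) (hg.2 x) (hk.2 x) ha hb hab
    · funext o
      cases o with
      | none =>
        have : ∫ x, (a • g + b • k) x ∂μ = a * ∫ x, g x ∂μ + b * ∫ x, k x ∂μ := by
          simp only [Pi.add_apply, Pi.smul_apply, smul_eq_mul]
          rw [integral_add ((hint g hg).const_mul a) ((hint k hk).const_mul b),
            integral_const_mul, integral_const_mul]
        simp only [v, Option.elim, Pi.add_apply, Pi.smul_apply, smul_eq_mul] at this ⊢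
        rw [this]
        linear_combination -(μ A).toReal * hab
      | some i =>
        have : ∫ x, u i x * (a • g + b • k) x ∂μ
            = a * ∫ x, u i x * g x ∂μ + b * ∫ x, u i x * k x ∂μ := by
          rw [← integral_const_mul, ← integral_const_mul,
            ← integral_add ((hintu g hg i).const_mul a) ((hintu k hk i).const_mul b)]
          congr 1; funext x
          simp only [Pi.add_apply, Pi.smul_apply, smul_eq_mul]
          ring
        simp only [v, Option.elim, Pi.add_apply, Pi.smul_apply, smul_eq_mul] at this ⊢
        rw [this]
        linear_combination (∫ x in A, u i x ∂μ) * hab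
  obtain ⟨w, hw, hw0, hwle⟩ := exists_nonneg_weights_of_convex hconv (by
    rintro _ ⟨g, hg, rfl⟩ hpos
    have hsome : ∀ i ∈ S, ∫ x in A, u i x ∂μ < ∫ x, u i x * g x ∂μ := fun i hi =>
      sub_pos.1 (hpos (some ⟨i, hi⟩))
    obtain ⟨j, hj⟩ := hS
    exact hpareto ⟨g, hg.1, hg.2, (sub_pos.1 (hpos none)).le, fun i hi => (hsome i hi).le,
      j, hj, hsome j hj⟩) ⟨_, 0, ⟨measurable_const, fun x => by simp⟩, rfl⟩
  let l : ι → ℝ := fun i => if hi : i ∈ S then w (some ⟨i, hi⟩) else 0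
  have hl : ∀ i : S, w (some i) = l i := fun i => by simp [l]
  have hset : ∀ B : Set α, ∫ x in B, (∑ i ∈ S, l i * u i x - w none) ∂μ
      = ∑ i ∈ S, l i * ∫ x in B, u i x ∂μ - w none * (μ B).toReal := fun B => by
    rw [integral_sub (integrable_finsetSum _ fun i _ => ((hu i).restrict).const_mul _)
      (integrable_const _), integral_finsetSum _ fun i _ => ((hu i).restrict).const_mul _]
    simp only [integral_const_mul]
    simp [Measure.real, mul_comm]
  refine ⟨l, w none, fun i hi => ?_, hw none, fun hc => ?_, fun B hB => ?_⟩
  · rw [← hl ⟨i, hi⟩]; exact hw _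
  · by_contra! hall
    refine hw0 (funext fun o => ?_)
    cases o with
    | none => exact hc
    | some i => rw [hl, hall i i.2]; rfl
  · have h := hwle _ ⟨B.indicator 1, ⟨measurable_one.indicator hB, fun x => ?_⟩, rfl⟩
    · have e1 : ∀ i, ∫ x, u i x * B.indicator 1 x ∂μ = ∫ x in B, u i x ∂μ := fun i => by
        rw [← integral_indicator hB]
        congr 1; funext x
        by_cases hx : x ∈ B <;> simp [hx]
      have e2 : ∫ x, B.indicator (1 : α → ℝ) x ∂μ = (μ B).toReal := integral_indicator_one hB
      simp only [Fintype.sum_option, v, Option.elim, e1, e2, hl] at h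
      rw [Finset.sum_coe_sort S fun i => l i * (∫ x in B, u i x ∂μ - ∫ x in A, u i x ∂μ)] at h
      simp only [mul_sub, Finset.sum_sub_distrib] at h
      rw [hset, hset]
      linarith
    · by_cases hx : x ∈ B <;> simp [hx]

/-- Every Pareto-optimal ex-ante allocation is a half-space up to
measure zero: if `𝒟` is an absolutely continuous probability measure on `[0,1]^n`,
`S` a nonempty coalition, and `A ⊆ [0,1]^n` measurable such that no randomized policy
`g : [0,1]^n → [0,1]` of cost at most `𝒟(A)` Pareto dominates `A` on `S`, then there
are weights `β_i ≥ 0` (`i ∈ S`) summing to `1` and a threshold `z ≥ 0` with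
`𝒟(A Δ {x ∈ [0,1]^n : ∑_{i∈S} β_i x_i ≥ z}) = 0`. -/
theorem statement11 {n : ℕ} (μ : Measure (Fin n → ℝ)) [IsProbabilityMeasure μ]
    (hac : μ ≪ (volume : Measure (Fin n → ℝ)))
    (hsupp : μ {x | ¬ ∀ i, x i ∈ Set.Icc (0 : ℝ) 1} = 0)
    (S : Finset (Fin n)) (hS : S.Nonempty)
    (A : Set (Fin n → ℝ)) (hAmeas : MeasurableSet A)
    (hAsub : A ⊆ {x | ∀ i, x i ∈ Set.Icc (0 : ℝ) 1})
    (hpareto : ¬ ∃ g : (Fin n → ℝ) → ℝ, Measurable g ∧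
      (∀ x, g x ∈ Set.Icc (0 : ℝ) 1) ∧
      (∫ x, g x ∂μ ≤ (μ A).toReal) ∧
      (∀ i ∈ S, ∫ x in A, x i ∂μ ≤ ∫ x, x i * g x ∂μ) ∧
      (∃ i ∈ S, ∫ x in A, x i ∂μ < ∫ x, x i * g x ∂μ)) :
    ∃ β : Fin n → ℝ, (∀ i ∈ S, 0 ≤ β i) ∧ (∑ i ∈ S, β i = 1) ∧
      ∃ z : ℝ, 0 ≤ z ∧
        μ (symmDiff A
          {x | (∀ i, x i ∈ Set.Icc (0 : ℝ) 1) ∧ z ≤ ∑ i ∈ S, β i * x i}) = 0 := by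
  classical
  have hcube : ∀ᵐ x ∂μ, ∀ i, x i ∈ Set.Icc (0 : ℝ) 1 := hsupp
  have hu : ∀ i, Integrable (fun x : Fin n → ℝ => x i) μ := fun i =>
    Integrable.of_bound (measurable_pi_apply i).aestronglyMeasurable 1 (by
      filter_upwards [hcube] with x hx
      rw [Real.norm_eq_abs, abs_of_nonneg (hx i).1]
      exact (hx i).2)
  obtain ⟨l, c, hl, hc, hne, hmax⟩ := exists_weights_of_paretoOptimal S hS
    (fun i (x : Fin n → ℝ) => x i) hu hpareto
  by_cases h : ∃ j ∈ S, l j ≠ 0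
  · obtain ⟨j, hj, hlj⟩ := h
    have hpos : 0 < ∑ i ∈ S, l i :=
      Finset.sum_pos' hl ⟨j, hj, lt_of_le_of_ne (hl j hj) hlj.symm⟩
    refine ⟨fun i => l i / ∑ i ∈ S, l i, fun i hi => div_nonneg (hl i hi) hpos.le, ?_,
      c / ∑ i ∈ S, l i, div_nonneg hc hpos.le, ?_⟩
    · rw [← Finset.sum_div, div_self hpos.ne']
    have hset : {x : Fin n → ℝ | (∀ i, x i ∈ Set.Icc (0 : ℝ) 1) ∧
          c / ∑ i ∈ S, l i ≤ ∑ i ∈ S, l i / (∑ i ∈ S, l i) * x i}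
        = {x | (∀ i, x i ∈ Set.Icc (0 : ℝ) 1) ∧ 0 ≤ ∑ i ∈ S, l i * x i - c} := by
      ext x
      simp only [div_mul_eq_mul_div, ← Finset.sum_div, div_le_div_iff_of_pos_right hpos,
        sub_nonneg]
    have hHmeas : MeasurableSet
        {x : Fin n → ℝ | (∀ i, x i ∈ Set.Icc (0 : ℝ) 1) ∧ 0 ≤ ∑ i ∈ S, l i * x i - c} := by
      have hm : Measurable fun x : Fin n → ℝ => ∑ i ∈ S, l i * x i - c := by fun_prop
      have hcm : MeasurableSet {x : Fin n → ℝ | ∀ i, x i ∈ Set.Icc (0 : ℝ) 1} := by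
        rw [Set.ofPred_forall]
        exact MeasurableSet.iInter fun i => measurable_pi_apply i measurableSet_Icc
      exact hcm.inter (measurableSet_le measurable_const hm)
    rw [hset]
    refine ae_eq_superlevel_of_setIntegral_le (h := fun x => ∑ i ∈ S, l i * x i - c)
      ((integrable_finsetSum _ fun i _ => (hu i).const_mul _).sub (integrable_const c))
      hAmeas hHmeas ?_ ?_ (hmax _ hHmeas)
    · filter_upwards [hcube] with x hx
      exact ⟨fun hx' => hx'.2, fun hx' => ⟨hx, hx'⟩⟩
    · have h0 := hac (volume_hyperplane_eq_zero S l hj hlj c)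
      filter_upwards [measure_eq_zero_iff_ae_notMem.1 h0] with x hx hx'
      exact hx (sub_eq_zero.1 hx')
  · have hcpos : 0 < c := lt_of_le_of_ne hc fun h0 => h (hne h0.symm)
    push Not at h
    have hlz : ∀ x : Fin n → ℝ, ∑ i ∈ S, l i * x i = 0 := fun x =>
      Finset.sum_eq_zero fun i hi => by rw [h i hi, zero_mul]
    have hA : μ A = 0 := by
      have hmA := hmax ∅ MeasurableSet.empty
      simp only [hlz, zero_sub, setIntegral_const, Measure.restrict_empty, integral_zero_measure,
        smul_eq_mul] at hmA
      have h1 : 0 ≤ μ.real A := measureReal_nonneg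
      have h2 : μ.real A = 0 := by nlinarith
      exact (measureReal_eq_zero_iff).1 h2
    obtain ⟨j, hj⟩ := hS
    refine ⟨Pi.single j 1, fun i _ => by rw [Pi.single_apply]; split_ifs <;> simp, ?_,
      2, zero_le_two, ?_⟩
    · simp [Pi.single_apply, hj]
    · have hempty : {x : Fin n → ℝ | (∀ i, x i ∈ Set.Icc (0 : ℝ) 1) ∧
          2 ≤ ∑ i ∈ S, (Pi.single j 1 : Fin n → ℝ) i * x i} = ∅ := by
        ext x
        simp only [Pi.single_apply, ite_mul, one_mul, zero_mul, Finset.sum_ite_eq', hj, if_true,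
          Set.mem_ofPred_eq, Set.mem_empty_iff_false, iff_false, not_and, not_le]
        intro hx
        linarith [(hx j).2]
      rw [hempty]
      simpa using hA
end

section
/- Let n, m ≥ 1, let (Ω, P) be a probability space with measurable maps V : Ω → [0,1]^{n×m} (values V_{i,k}(ω) of agent i for good k) and c : Ω → { set functions from subsets of {1,…,n}×{1,…,m} to [0,1] }. For a measurable allocation policy A : Ω → subsets of {1,…,n}×{1,…,m}, write A_i(ω) = {k : (i,k) ∈ A(ω)}, U_i(A) = E[Σ_{k∈A_i(ω)} V_{i,k}(ω)], and C(A) = E[c(ω)(A(ω))]. Let γ ≥ 0, α_1,…,α_n ≥ 0, and let A be a policy with C(A) ≤ Σ_{i=1}^n α_i. Suppose for every nonempty S ⊆ {1,…,n} there exist β ∈ (0,∞)^n, z ≥ 0, and a measurable policy B such that: (i) for every ω, B(ω) maximizes X ↦ Σ_{i∈S} Σ_{k : (i,k)∈X} β_i·V_{i,k}(ω) − z·c(ω)(X) over all subsets X of {1,…,n}×{1,…,m}; (ii) C(B) ≥ Σ_{i∈S} α_i; and (iii) (1+γ)·Σ_{i∈S} β_i·U_i(A) ≥ Σ_{i∈S}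 β_i·U_i(B). Then for every nonempty S ⊆ {1,…,n} and every measurable policy A' with C(A') ≤ Σ_{i∈S} α_i, either there exists i ∈ S with (1+γ)·U_i(A) > U_i(A'), or (1+γ)·U_i(A) = U_i(A') for all i ∈ S. -/
open MeasureTheory

/-- The ex-ante cost `C(A) = E[c(ω)(A(ω))]` of an allocation policy `A`. -/
noncomputable def exCost {Ω : Type*} [MeasurableSpace Ω] {n m : ℕ}
    (P : Measure Ω) (c : Ω → Finset (Fin n × Fin m) → ℝ)
    (A : Ω → Finset (Fin n × Fin m)) : ℝ :=
  ∫ ω, c ω (A ω) ∂P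

/-- The ex-ante utility `U_i(A) = E[∑_{k ∈ A_i(ω)} V_{i,k}(ω)]` of agent `i` under an
allocation policy `A`, where `A_i(ω) = {k : (i,k) ∈ A(ω)}`. -/
noncomputable def exUtil {Ω : Type*} [MeasurableSpace Ω] {n m : ℕ}
    (P : Measure Ω) (V : Ω → Fin n → Fin m → ℝ)
    (A : Ω → Finset (Fin n × Fin m)) (i : Fin n) : ℝ :=
  ∫ ω, ∑ e ∈ A ω, (if e.1 = i then V ω i e.2 else 0) ∂P

/-- A policy `A : Ω → 2^{[n]×[m]}` is measurable. -/
def MeasPolicy {Ω : Type*} [MeasurableSpace Ω] {n m : ℕ}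
    (A : Ω → Finset (Fin n × Fin m)) : Prop :=
  ∀ X : Finset (Fin n × Fin m), MeasurableSet {ω | A ω = X}

/-- Composing a measurable policy with a family of integrable functions, indexed by the chosen
set, gives an integrable function. -/
theorem MeasPolicy.integrable_comp {Ω : Type*} [MeasurableSpace Ω] {n m : ℕ} {P : Measure Ω}
    {A : Ω → Finset (Fin n × Fin m)} (hA : MeasPolicy A)
    {g : Ω → Finset (Fin n × Fin m) → ℝ} (hg : ∀ X, Integrable (fun ω => g ω X) P) :
    Integrable (fun ω => g ω (A ω)) P := by
  have h : (fun ω => g ω (A ω)) =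
      fun ω => ∑ X, Set.indicator {ω | A ω = X} (fun ω => g ω X) ω := by
    funext ω
    simp [Set.indicator_apply]
  rw [h]
  exact integrable_finsetSum _ fun X _ => (hg X).indicator (hA X)

/-- The integrand in the ex-ante utility of agent `i` is integrable. -/
theorem MeasPolicy.integrable_util {Ω : Type*} [MeasurableSpace Ω] {n m : ℕ} {P : Measure Ω}
    {V : Ω → Fin n → Fin m → ℝ} (hV : ∀ i k, Integrable (fun ω => V ω i k) P)
    {A : Ω → Finset (Fin n × Fin m)} (hA : MeasPolicy A) (i : Fin n) :
    Integrable (fun ω => ∑ e ∈ A ω, (if e.1 = i then V ω i e.2 else 0)) P := by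
  refine hA.integrable_comp
    (g := fun ω X => ∑ e ∈ X, (if e.1 = i then V ω i e.2 else 0)) fun X => ?_
  refine integrable_finsetSum _ fun e _ => ?_
  by_cases h : e.1 = i
  · simpa [h] using hV i e.2
  · simp [h]

/-- Pointwise, the weighted welfare of a coalition is the weighted sum of its members' values. -/
theorem sum_weighted_value {n m : ℕ} (S : Finset (Fin n)) (β : Fin n → ℝ)
    (v : Fin n → Fin m → ℝ) (X : Finset (Fin n × Fin m)) :
    ∑ e ∈ X, (if e.1 ∈ S then β e.1 * v e.1 e.2 else 0) =
      ∑ i ∈ S, β i * ∑ e ∈ X, (if e.1 = i then v i e.2 else 0) := by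
  simp_rw [Finset.mul_sum]
  rw [Finset.sum_comm]
  refine Finset.sum_congr rfl fun e _ => ?_
  simp

/-- The expected weighted welfare minus scaled cost, in terms of ex-ante utilities and cost. -/
theorem integral_welfare_sub_cost {Ω : Type*} [MeasurableSpace Ω] {n m : ℕ} {P : Measure Ω}
    {V : Ω → Fin n → Fin m → ℝ} (hV : ∀ i k, Integrable (fun ω => V ω i k) P)
    {c : Ω → Finset (Fin n × Fin m) → ℝ} (hc : ∀ X, Integrable (fun ω => c ω X) P)
    {A : Ω → Finset (Fin n × Fin m)} (hA : MeasPolicy A)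
    (S : Finset (Fin n)) (β : Fin n → ℝ) (z : ℝ) :
    Integrable (fun ω => ∑ e ∈ A ω, (if e.1 ∈ S then β e.1 * V ω e.1 e.2 else 0)
      - z * c ω (A ω)) P ∧
    ∫ ω, (∑ e ∈ A ω, (if e.1 ∈ S then β e.1 * V ω e.1 e.2 else 0) - z * c ω (A ω)) ∂P =
      ∑ i ∈ S, β i * exUtil P V A i - z * exCost P c A := by
  have hu (i : Fin n) := (hA.integrable_util hV i).const_mul (β i)
  have hs := integrable_finsetSum S fun i _ => hu i
  have hz := (hA.integrable_comp hc).const_mul z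
  simp_rw [sum_weighted_value]
  refine ⟨hs.sub hz, ?_⟩
  rw [integral_sub hs hz, integral_finsetSum S fun i _ => hu i]
  simp_rw [integral_const_mul]
  rfl

/-- General sufficient criterion for the `γ`-approximate ex-ante
core: a feasible policy `A` is in the `γ`-approximate ex-ante core provided that, for
each nonempty coalition `S`, some pointwise maximizer `B` of the β-weighted welfare
minus `z`-scaled cost has ex-ante cost at least the coalition's share and β-weighted
coalition utility within a `(1+γ)` factor of that of `A`. -/
theorem statement12 {Ω : Type*} [MeasurableSpace Ω] {n m : ℕ}
    (hn : 1 ≤ n) (hm : 1 ≤ m)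
    (P : Measure Ω) [IsProbabilityMeasure P]
    (V : Ω → Fin n → Fin m → ℝ)
    (hVmeas : ∀ i k, Measurable fun ω => V ω i k)
    (hVrange : ∀ ω i k, V ω i k ∈ Set.Icc (0 : ℝ) 1)
    (c : Ω → Finset (Fin n × Fin m) → ℝ)
    (hcmeas : ∀ X, Measurable fun ω => c ω X)
    (hcrange : ∀ ω X, c ω X ∈ Set.Icc (0 : ℝ) 1)
    (γ : ℝ) (hγ : 0 ≤ γ) (α : Fin n → ℝ) (hα : ∀ i, 0 ≤ α i)
    (A : Ω → Finset (Fin n × Fin m)) (hA : MeasPolicy A)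
    (hfeas : exCost P c A ≤ ∑ i, α i)
    (hyp : ∀ S : Finset (Fin n), S.Nonempty →
      ∃ β : Fin n → ℝ, (∀ i, 0 < β i) ∧ ∃ z : ℝ, 0 ≤ z ∧
        ∃ B : Ω → Finset (Fin n × Fin m), MeasPolicy B ∧
          (∀ ω, ∀ X : Finset (Fin n × Fin m),
            ∑ e ∈ X, (if e.1 ∈ S then β e.1 * V ω e.1 e.2 else 0) - z * c ω X ≤
              ∑ e ∈ B ω, (if e.1 ∈ S then β e.1 * V ω e.1 e.2 else 0)
                - z * c ω (B ω)) ∧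
          (∑ i ∈ S, α i ≤ exCost P c B) ∧
          (∑ i ∈ S, β i * exUtil P V B i ≤ (1 + γ) * ∑ i ∈ S, β i * exUtil P V A i)) :
    ∀ S : Finset (Fin n), S.Nonempty →
      ∀ A' : Ω → Finset (Fin n × Fin m), MeasPolicy A' →
        exCost P c A' ≤ ∑ i ∈ S, α i →
        (∃ i ∈ S, exUtil P V A' i < (1 + γ) * exUtil P V A i) ∨
        (∀ i ∈ S, (1 + γ) * exUtil P V A i = exUtil P V A' i) := by
  intro S hS A' hA' hcost
  obtain ⟨β, hβ, z, hz, B, hB, hmax, hBcost, hButil⟩ := hyp S hS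
  have hV (i : Fin n) (k : Fin m) : Integrable (fun ω => V ω i k) P :=
    Integrable.of_mem_Icc 0 1 (hVmeas i k).aemeasurable (.of_forall fun ω => hVrange ω i k)
  have hc (X : Finset (Fin n × Fin m)) : Integrable (fun ω => c ω X) P :=
    Integrable.of_mem_Icc 0 1 (hcmeas X).aemeasurable (.of_forall fun ω => hcrange ω X)
  obtain ⟨intA', eqA'⟩ := integral_welfare_sub_cost hV hc hA' S β z
  obtain ⟨intB, eqB⟩ := integral_welfare_sub_cost hV hc hB S β z
  have hle := integral_mono intA' intB fun ω => hmax ω (A' ω)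
  rw [eqA', eqB] at hle
  have hzc := mul_le_mul_of_nonneg_left (hcost.trans hBcost) hz
  have hsum : ∑ i ∈ S, β i * exUtil P V A' i ≤ ∑ i ∈ S, β i * ((1 + γ) * exUtil P V A i) := by
    simp_rw [mul_left_comm (β _)]
    rw [← Finset.mul_sum]
    linarith
  by_cases h : ∃ i ∈ S, exUtil P V A' i < (1 + γ) * exUtil P V A i
  · exact .inl h
  · push Not at h
    have hterm : ∀ i ∈ S, β i * ((1 + γ) * exUtil P V A i) ≤ β i * exUtil P V A' i :=
      fun i hi => mul_le_mul_of_nonneg_left (h i hi) (hβ i).le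
    have heq := (Finset.sum_eq_sum_iff_of_le hterm).1 ((Finset.sum_le_sum hterm).antisymm hsum)
    exact .inr fun i hi => mul_left_cancel₀ (hβ i).ne' (heq i hi)
end

section
/- Let (A*, p) be a one-shot multi-good mechanism among n agents and m goods satisfying (IC) and (MT3). Then for every agent i and all report profiles Ṽ, Ṽ' ∈ [0,∞)^{n×m} with Ṽ'_{j,k} ≤ Ṽ_{j,k} for all j ≠ i and all k: Σ_{k∈A*_i(Ṽ)} Ṽ_{i,k} − p_i(Ṽ) ≥ Σ_{k∈A*_i(Ṽ')} Ṽ_{i,k} − p_i(Ṽ'). -/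
/-- For a one-shot multi-good mechanism `(A*, p)` satisfying
incentive compatibility (IC) and utility monotonicity (MT3): agent `i`'s quasi-linear
utility (evaluated at their own report `Ṽ_i`) does not decrease when the other agents'
reports increase, i.e. if `Ṽ'_{j,k} ≤ Ṽ_{j,k}` for all `j ≠ i` and all `k`, then
`∑_{k∈A*_i(Ṽ)} Ṽ_{i,k} − p_i(Ṽ) ≥ ∑_{k∈A*_i(Ṽ')} Ṽ_{i,k} − p_i(Ṽ')`. -/
theorem statement13 {n m : ℕ}
    (Astar : (Fin n → Fin m → ℝ) → Finset (Fin n × Fin m))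
    (p : (Fin n → Fin m → ℝ) → Fin n → ℝ)
    (hIC : ∀ (Vt : Fin n → Fin m → ℝ) (i : Fin n) (Wi : Fin m → ℝ),
      (∀ j k, 0 ≤ Vt j k) → (∀ k, 0 ≤ Wi k) →
      ∑ k ∈ Finset.univ.filter
          (fun k : Fin m => (i, k) ∈ Astar (Function.update Vt i Wi)), Vt i k
        - p (Function.update Vt i Wi) i ≤
      ∑ k ∈ Finset.univ.filter (fun k : Fin m => (i, k) ∈ Astar Vt), Vt i k - p Vt i)
    (hMT3 : ∀ Vt Vt' : Fin n → Fin m → ℝ, (∀ j k, 0 ≤ Vt' j k) →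
      (∀ j k, Vt' j k ≤ Vt j k) → ∀ i,
      ∑ k ∈ Finset.univ.filter (fun k : Fin m => (i, k) ∈ Astar Vt'), Vt' i k
        - p Vt' i ≤
      ∑ k ∈ Finset.univ.filter (fun k : Fin m => (i, k) ∈ Astar Vt), Vt i k - p Vt i)
    (i : Fin n) (Vt Vt' : Fin n → Fin m → ℝ)
    (hVt' : ∀ j k, 0 ≤ Vt' j k) (hVt : ∀ j k, 0 ≤ Vt j k)
    (hle : ∀ j, j ≠ i → ∀ k, Vt' j k ≤ Vt j k) :
    ∑ k ∈ Finset.univ.filter (fun k : Fin m => (i, k) ∈ Astar Vt'), Vt i k - p Vt' i ≤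
      ∑ k ∈ Finset.univ.filter (fun k : Fin m => (i, k) ∈ Astar Vt), Vt i k
        - p Vt i := by
  have hU : ∀ j k, 0 ≤ Function.update Vt' i (Vt i) j k := by
    intro j k
    by_cases h : j = i
    · subst h
      simpa using hVt j k
    · simpa [h] using hVt' j k
  have hUle : ∀ j k, Function.update Vt' i (Vt i) j k ≤ Vt j k := by
    intro j k
    by_cases h : j = i
    · subst h
      simp
    · simpa [h] using hle j h k
  have hdev := hIC (Function.update Vt' i (Vt i)) i (Vt' i) hU (hVt' i)
  have hmono := hMT3 Vt (Function.update Vt' i (Vt i)) hU hUle i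
  rw [Function.update_idem, Function.update_eq_self] at hdev
  rw [Function.update_self] at hdev hmono
  exact hdev.trans hmono
end

section
/- Let (A*, p) be a one-shot multi-good mechanism among n agents and m goods satisfying (MT3) and (MT5). Then for any agent i and report profiles Ṽ, Ṽ' ∈ [0,∞)^{n×m} with Ṽ'_{i,k} ≤ Ṽ_{i,k} for all k: if A*_i(Ṽ) = A*_i(Ṽ'_i, Ṽ_{−i}), then p_j(Ṽ) ≤ p_j(Ṽ'_i, Ṽ_{−i}) for all j ≠ i. -/
/-- For a one-shot multi-good mechanism `(A*, p)` satisfying (MT3)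
and (MT5): if agent `i` lowers their report (from `Ṽ_i` to `W_i ≤ Ṽ_i`) without
changing their own allocation, then no other agent pays less, i.e.
`p_j(Ṽ) ≤ p_j(W_i, Ṽ_{−i})` for all `j ≠ i`. -/
theorem statement14 {n m : ℕ}
    (Astar : (Fin n → Fin m → ℝ) → Finset (Fin n × Fin m))
    (p : (Fin n → Fin m → ℝ) → Fin n → ℝ)
    (hMT3 : ∀ Vt Vt' : Fin n → Fin m → ℝ, (∀ j k, 0 ≤ Vt' j k) →
      (∀ j k, Vt' j k ≤ Vt j k) → ∀ i,
      ∑ k ∈ Finset.univ.filter (fun k : Fin m => (i, k) ∈ Astar Vt'), Vt' i k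
        - p Vt' i ≤
      ∑ k ∈ Finset.univ.filter (fun k : Fin m => (i, k) ∈ Astar Vt), Vt i k - p Vt i)
    (hMT5 : ∀ Vt Vt' : Fin n → Fin m → ℝ, (∀ j k, 0 ≤ Vt' j k) →
      (∀ j k, Vt' j k ≤ Vt j k) → ∀ i,
      Finset.univ.filter (fun k : Fin m => (i, k) ∈ Astar Vt) =
        Finset.univ.filter
          (fun k : Fin m => (i, k) ∈ Astar (Function.update Vt i (Vt' i))) →
      Astar Vt = Astar (Function.update Vt i (Vt' i)))
    (i : Fin n) (Vt : Fin n → Fin m → ℝ) (Wi : Fin m → ℝ)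
    (hVt : ∀ j k, 0 ≤ Vt j k) (hWi : ∀ k, 0 ≤ Wi k) (hle : ∀ k, Wi k ≤ Vt i k)
    (hsame : Finset.univ.filter (fun k : Fin m => (i, k) ∈ Astar Vt) =
      Finset.univ.filter
        (fun k : Fin m => (i, k) ∈ Astar (Function.update Vt i Wi))) :
    ∀ j, j ≠ i → p Vt j ≤ p (Function.update Vt i Wi) j := by
  have hnonneg : ∀ j k, 0 ≤ Function.update Vt i Wi j k := by
    intro j k
    by_cases h : j = i
    · subst h
      simpa using hWi k
    · simpa [h] using hVt j k
  have hupdate_le : ∀ j k, Function.update Vt i Wi j k ≤ Vt j k := by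
    intro j k
    by_cases h : j = i
    · subst h
      simpa using hle k
    · simp [h]
  have hA : Astar Vt = Astar (Function.update Vt i Wi) := by
    have h := hMT5 Vt (Function.update Vt i Wi) hnonneg hupdate_le i
    rw [Function.update_self] at h
    exact h hsame
  intro j hj
  have h := hMT3 Vt (Function.update Vt i Wi) hnonneg hupdate_le j
  rw [← hA, Function.update_of_ne hj] at h
  linarith
end

section
/- Let E = {1,…,n}×{1,…,m} and let g : 2^E → ℝ be submodular, i.e. g(X ∪ Y) + g(X ∩ Y) ≤ g(X) + g(Y) for all X, Y ⊆ E. Let V, V' : E → [0,∞) with V(e) ≥ V'(e) for all e ∈ E. Let A be a maximizer of f_V(X) = Σ_{e∈X} V(e) − g(X) over subsets of E having maximum cardinality among all maximizers of f_V, and let A' likewise be a maximum-cardinality maximizer of f_{V'}(X) = Σ_{e∈X} V'(e) − g(X). Then A' ⊆ A. -/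
/-- Allocation monotonicity of welfare-minus-submodular-cost
maximizers: if `g` is submodular on `E = [n]×[m]`, `V ≥ V' ≥ 0`, `A` is a
maximum-cardinality maximizer of `X ↦ ∑_{e∈X} V(e) − g(X)`, and `A'` a
maximum-cardinality maximizer of `X ↦ ∑_{e∈X} V'(e) − g(X)`, then `A' ⊆ A`. -/
theorem statement15 {n m : ℕ} (g : Finset (Fin n × Fin m) → ℝ)
    (hsub : ∀ X Y : Finset (Fin n × Fin m), g (X ∪ Y) + g (X ∩ Y) ≤ g X + g Y)
    (V V' : Fin n × Fin m → ℝ) (hV' : ∀ e, 0 ≤ V' e) (hle : ∀ e, V' e ≤ V e)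
    (A A' : Finset (Fin n × Fin m))
    (hA : ∀ X : Finset (Fin n × Fin m),
      ∑ e ∈ X, V e - g X ≤ ∑ e ∈ A, V e - g A)
    (hAcard : ∀ X : Finset (Fin n × Fin m),
      (∑ e ∈ X, V e - g X = ∑ e ∈ A, V e - g A) → X.card ≤ A.card)
    (hA' : ∀ X : Finset (Fin n × Fin m),
      ∑ e ∈ X, V' e - g X ≤ ∑ e ∈ A', V' e - g A')
    (hA'card : ∀ X : Finset (Fin n × Fin m),
      (∑ e ∈ X, V' e - g X = ∑ e ∈ A', V' e - g A') → X.card ≤ A'.card) :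
    A' ⊆ A := by
  have hunion : ∑ e ∈ A ∪ A', V e = ∑ e ∈ A, V e + ∑ e ∈ A' \ A, V e := by
    rw [← Finset.union_sdiff_self_eq_union, Finset.sum_union Finset.disjoint_sdiff]
  have hinter : ∑ e ∈ A ∩ A', V' e + ∑ e ∈ A' \ A, V' e = ∑ e ∈ A', V' e := by
    rw [Finset.inter_comm, Finset.sum_inter_add_sum_sdiff]
  have hdiff : ∑ e ∈ A' \ A, V' e ≤ ∑ e ∈ A' \ A, V e :=
    Finset.sum_le_sum fun e _ => hle e
  have hopt : ∑ e ∈ A ∪ A', V e - g (A ∪ A') = ∑ e ∈ A, V e - g A :=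
    le_antisymm (hA _) (by linarith [hsub A A', hA' (A ∩ A')])
  have heq : A = A ∪ A' :=
    Finset.eq_of_subset_of_card_le Finset.subset_union_left (hAcard _ hopt)
  exact Finset.union_eq_left.mp heq.symm
end

section
/- Let E = {1,…,n}×{1,…,m} and let g : 2^E → ℝ be submodular. Fix an agent i, and let V, V' : E → [0,∞) with V'(i,k) ≤ V(i,k) for all k and V'(j,k) = V(j,k) for all j ≠ i and all k. Let A be a maximum-cardinality maximizer of f_V(X) = Σ_{e∈X} V(e) − g(X), and let A' be a maximum-cardinality maximizer of f_{V'}(X) = Σ_{e∈X} V'(e) − g(X). Then Σ_{j≠i} Σ_{k : (j,k)∈A'} V(j,k) − g(A') ≥ Σ_{j≠i} Σ_{k : (j,k)∈A} V(j,k) − g(A). -/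
/-- If `g` is submodular, `w' ≤ w`, `A` is a maximum-cardinality maximizer of
`X ↦ ∑ e ∈ X, w e - g X` and `A'` maximizes `X ↦ ∑ e ∈ X, w' e - g X`, then `A' ⊆ A`. -/
theorem subset_of_maximizers_of_submodular {α : Type*} [DecidableEq α] {g : Finset α → ℝ}
    (hsub : ∀ X Y : Finset α, g (X ∪ Y) + g (X ∩ Y) ≤ g X + g Y)
    {w w' : α → ℝ} (hle : ∀ e, w' e ≤ w e) {A A' : Finset α}
    (hA : ∀ X : Finset α, ∑ e ∈ X, w e - g X ≤ ∑ e ∈ A, w e - g A)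
    (hAcard : ∀ X : Finset α,
      (∑ e ∈ X, w e - g X = ∑ e ∈ A, w e - g A) → X.card ≤ A.card)
    (hA' : ∀ X : Finset α, ∑ e ∈ X, w' e - g X ≤ ∑ e ∈ A', w' e - g A') :
    A' ⊆ A := by
  have hmod := Finset.sum_union_inter (s₁ := A) (s₂ := A') (f := w)
  have hdiff : ∑ e ∈ A' \ A, w' e ≤ ∑ e ∈ A' \ A, w e :=
    Finset.sum_le_sum fun e _ => hle e
  have hw := Finset.sum_inter_add_sum_sdiff A' A w
  have hw' := Finset.sum_inter_add_sum_sdiff A' A w'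
  rw [Finset.inter_comm A' A] at hw hw'
  have hcard : (A ∪ A').card ≤ A.card :=
    hAcard _ (le_antisymm (hA _) (by linarith [hsub A A', hA' (A ∩ A')]))
  rw [Finset.eq_of_subset_of_card_le Finset.subset_union_left hcard]
  exact Finset.subset_union_right

/-- Payment monotonicity of the Potential mechanism (via VCG): let
`g` be submodular on `E = [n]×[m]`, let `V'` agree with `V` off agent `i`'s row and be
lower on it, and let `A`, `A'` be maximum-cardinality maximizers of
`X ↦ ∑_{e∈X} V(e) − g(X)` and `X ↦ ∑_{e∈X} V'(e) − g(X)` respectively. Then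
`∑_{j≠i} ∑_{k:(j,k)∈A'} V(j,k) − g(A') ≥ ∑_{j≠i} ∑_{k:(j,k)∈A} V(j,k) − g(A)`. -/
theorem statement16 {n m : ℕ} (g : Finset (Fin n × Fin m) → ℝ)
    (hsub : ∀ X Y : Finset (Fin n × Fin m), g (X ∪ Y) + g (X ∩ Y) ≤ g X + g Y)
    (i : Fin n) (V V' : Fin n × Fin m → ℝ)
    (hV' : ∀ e, 0 ≤ V' e) (hV : ∀ e, 0 ≤ V e)
    (hlei : ∀ k, V' (i, k) ≤ V (i, k))
    (heq : ∀ j, j ≠ i → ∀ k, V' (j, k) = V (j, k))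
    (A A' : Finset (Fin n × Fin m))
    (hA : ∀ X : Finset (Fin n × Fin m),
      ∑ e ∈ X, V e - g X ≤ ∑ e ∈ A, V e - g A)
    (hAcard : ∀ X : Finset (Fin n × Fin m),
      (∑ e ∈ X, V e - g X = ∑ e ∈ A, V e - g A) → X.card ≤ A.card)
    (hA' : ∀ X : Finset (Fin n × Fin m),
      ∑ e ∈ X, V' e - g X ≤ ∑ e ∈ A', V' e - g A')
    (hA'card : ∀ X : Finset (Fin n × Fin m),
      (∑ e ∈ X, V' e - g X = ∑ e ∈ A', V' e - g A') → X.card ≤ A'.card) :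
    ∑ e ∈ A.filter (fun e => e.1 ≠ i), V e - g A ≤
      ∑ e ∈ A'.filter (fun e => e.1 ≠ i), V e - g A' := by
  have hle : ∀ e, V' e ≤ V e := by
    rintro ⟨j, k⟩
    by_cases hj : j = i
    · exact hj ▸ hlei k
    · exact (heq j hj k).le
  have hAA' : A' ⊆ A := subset_of_maximizers_of_submodular hsub hle hA hAcard hA'
  have hrow : ∑ e ∈ A' with ¬ e.1 ≠ i, V' e ≤ ∑ e ∈ A with ¬ e.1 ≠ i, V' e :=
    Finset.sum_le_sum_of_subset_of_nonneg (Finset.filter_subset_filter _ hAA')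
      fun e _ _ => hV' e
  have hoff : ∀ X : Finset (Fin n × Fin m),
      ∑ e ∈ X with e.1 ≠ i, V' e = ∑ e ∈ X with e.1 ≠ i, V e := fun X =>
    Finset.sum_congr rfl fun e he => heq e.1 (Finset.mem_filter.1 he).2 e.2
  have hsplit := Finset.sum_filter_add_sum_filter_not A (fun e => e.1 ≠ i) V'
  have hsplit' := Finset.sum_filter_add_sum_filter_not A' (fun e => e.1 ≠ i) V'
  linarith [hA' A, hoff A, hoff A']
end

section
/- Let n, m ≥ 1, let E = {1,…,n}×{1,…,m}, and let c : 2^E → ℝ satisfy c(∅) = 0 and monotonicity (X ⊆ Y implies c(X) ≤ c(Y)). Define the potential P_c(X) = Σ_{∅ ≠ I ⊆ {1,…,n}} c({(i,k) ∈ X : i ∈ I}) / (|I|·binom(n,|I|)). Let V : E → [0,∞), let A* be a maximizer of X ↦ Σ_{e∈X} V(e) − P_c(X) over subsets of E, and let p_1,…,p_n ∈ ℝ satisfy Σ_{i=1}^n p_i ≤ P_c(A*). Then for every nonempty A' ⊆ E: ( Σ_{e∈A'} V(e) − c(A') )⁺ − ( Σ_{e∈A*} V(e) − Σ_{i=1}^n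 p_i ) ≤ (H_n − 1)·c(A'), where H_n = Σ_{j=1}^n 1/j and (x)⁺ = max(x,0). -/
/-- The weights of the potential over nonempty subsets of an `n`-element set sum to the harmonic
number `H_n`. -/
theorem sum_nonempty_inv_card_mul_choose (n : ℕ) :
    ∑ I ∈ Finset.univ.powerset.filter (fun I : Finset (Fin n) => I.Nonempty),
      1 / ((I.card : ℝ) * (n.choose I.card : ℝ)) = ∑ j ∈ Finset.Icc 1 n, (1 : ℝ) / j := by
  have hdrop : ∑ I ∈ Finset.univ.powerset.filter (fun I : Finset (Fin n) => I.Nonempty),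
      1 / ((I.card : ℝ) * (n.choose I.card : ℝ)) =
      ∑ I ∈ (Finset.univ : Finset (Fin n)).powerset,
        1 / ((I.card : ℝ) * (n.choose I.card : ℝ)) := by
    refine Finset.sum_filter_of_ne fun I _ hI => ?_
    rw [Finset.nonempty_iff_ne_empty]
    rintro rfl
    simp at hI
  rw [hdrop, Finset.sum_powerset_apply_card
    (fun k : ℕ => 1 / ((k : ℝ) * (n.choose k : ℝ))),
    Finset.card_univ, Fintype.card_fin, Finset.sum_range_succ', Finset.range_eq_Ico,
    Finset.sum_Ico_add' (fun k : ℕ => n.choose k • (1 / ((k : ℝ) * (n.choose k : ℝ)))) 0 n 1]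
  simp only [Nat.cast_zero, zero_mul, div_zero, smul_zero, add_zero, zero_add]
  refine Finset.sum_congr rfl fun k hk => ?_
  have hchoose : (n.choose k : ℝ) ≠ 0 := by
    have := Nat.choose_pos (Finset.mem_Icc.1 hk).2
    positivity
  rw [nsmul_eq_mul]
  field_simp

/-- Dead-weight-loss bound for the Potential mechanism: with `c`
monotone, normalized, and `P_c` its potential, if `A*` maximizes
`X ↦ ∑_{e∈X} V(e) − P_c(X)` and the payments satisfy `∑_i p_i ≤ P_c(A*)`, then for
every nonempty allocation `A'`,
`(∑_{e∈A'} V(e) − c(A'))⁺ − (∑_{e∈A*} V(e) − ∑_i p_i) ≤ (H_n − 1)·c(A')`. -/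
theorem statement17 {n m : ℕ} (hn : 1 ≤ n) (hm : 1 ≤ m)
    (c : Finset (Fin n × Fin m) → ℝ) (hc0 : c ∅ = 0)
    (hcmono : ∀ X Y : Finset (Fin n × Fin m), X ⊆ Y → c X ≤ c Y)
    (Pc : Finset (Fin n × Fin m) → ℝ)
    (hPc : ∀ X : Finset (Fin n × Fin m),
      Pc X = ∑ I ∈ Finset.univ.powerset.filter (fun I : Finset (Fin n) => I.Nonempty),
        c (X.filter fun e => e.1 ∈ I) / ((I.card : ℝ) * (n.choose I.card : ℝ)))
    (V : Fin n × Fin m → ℝ) (hV : ∀ e, 0 ≤ V e)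
    (Astar : Finset (Fin n × Fin m))
    (hAstar : ∀ X : Finset (Fin n × Fin m),
      ∑ e ∈ X, V e - Pc X ≤ ∑ e ∈ Astar, V e - Pc Astar)
    (p : Fin n → ℝ) (hp : ∑ i, p i ≤ Pc Astar)
    (A' : Finset (Fin n × Fin m)) (hA' : A'.Nonempty) :
    max (∑ e ∈ A', V e - c A') 0 - (∑ e ∈ Astar, V e - ∑ i, p i) ≤
      ((∑ j ∈ Finset.Icc 1 n, (1 : ℝ) / j) - 1) * c A' := by
  have hcA : 0 ≤ c A' := hc0 ▸ hcmono ∅ A' (Finset.empty_subset _)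
  have hPA : Pc A' ≤ (∑ j ∈ Finset.Icc 1 n, (1 : ℝ) / j) * c A' := by
    rw [hPc, ← sum_nonempty_inv_card_mul_choose, Finset.sum_mul]
    refine Finset.sum_le_sum fun I _ => ?_
    rw [one_div_mul_eq_div]
    gcongr
    exact hcmono _ _ (Finset.filter_subset _ _)
  have hP0 : Pc ∅ = 0 := by simp [hPc, hc0]
  have hH : (1 : ℝ) ≤ ∑ j ∈ Finset.Icc 1 n, (1 : ℝ) / j := by
    simpa using Finset.single_le_sum (f := fun j : ℕ => (1 : ℝ) / j)
      (fun j _ => by positivity) (Finset.mem_Icc.2 ⟨le_rfl, hn⟩)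
  have hloss := mul_nonneg (sub_nonneg.2 hH) hcA
  have hA := hAstar A'
  have hempty := hAstar ∅
  rw [Finset.sum_empty, hP0] at hempty
  rw [sub_le_iff_le_add]
  exact max_le (by linarith) (by linarith)
end

section
/- Define the proportional mechanism for a single good of cost 1 among n agents: for Ṽ ∈ [0,∞)^n, if Σ_j Ṽ_j ≥ 1 then A*(Ṽ) = {1,…,n} and p_i(Ṽ) = Ṽ_i / Σ_j Ṽ_j for all i; otherwise A*(Ṽ) = ∅ and p_i(Ṽ) = 0 for all i. Then: (i) (IR) holds, and whenever the good is allocated Σ_i p_i(Ṽ) = 1, so (CC) holds; (ii) (MT3) holds: for all Ṽ ≥ Ṽ' coordinatewise and all i, Ṽ_i·1[Σ_j Ṽ_j ≥ 1] − p_i(Ṽ) ≥ Ṽ'_i·1[Σ_j Ṽ'_j ≥ 1] − p_i(Ṽ'); (iii) (PS) holds: for all i, all Ṽ_{−i} ∈ [0,∞)^{n−1} and all 0 ≤ Ṽ_i ≤ W_i, Ṽ_i·1[i ∈ A*(Ṽ_i, Ṽ_{−i})] − p_i(Ṽ_i, Ṽ_{−i}) ≥ Ṽ_i·1[i ∈ A*(W_i,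 Ṽ_{−i})] − p_i(W_i, Ṽ_{−i}); and (iv) the dead-weight loss satisfies DWL(Ṽ) = (Σ_{i∉A*(Ṽ)} Ṽ_i + Σ_i p_i(Ṽ) − 1)⁺ = 0 for all Ṽ. -/
/-- The allocation rule of the proportional mechanism: allocate to everyone if the
total reported value is at least the cost `1`, otherwise to nobody. -/
noncomputable def propA {n : ℕ} (V : Fin n → ℝ) : Finset (Fin n) :=
  if 1 ≤ ∑ j, V j then Finset.univ else ∅

/-- The payment rule of the proportional mechanism: if the good is allocated, agent `i`
pays `V_i / ∑_j V_j`; otherwise everyone pays `0`. -/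
noncomputable def propP {n : ℕ} (V : Fin n → ℝ) (i : Fin n) : ℝ :=
  if 1 ≤ ∑ j, V j then V i / ∑ j, V j else 0

theorem propP_of_one_le {n : ℕ} {V : Fin n → ℝ} (h : 1 ≤ ∑ j, V j) (i : Fin n) :
    propP V i = V i / ∑ j, V j := if_pos h

theorem propP_of_not_one_le {n : ℕ} {V : Fin n → ℝ} (h : ¬ 1 ≤ ∑ j, V j) (i : Fin n) :
    propP V i = 0 := if_neg h

theorem mem_propA {n : ℕ} {V : Fin n → ℝ} {i : Fin n} : i ∈ propA V ↔ 1 ≤ ∑ j, V j := by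
  unfold propA
  split_ifs with h <;> simp [h]

/-- A nonnegative agent pays at most the report. -/
theorem propP_le {n : ℕ} {V : Fin n → ℝ} {i : Fin n} (h0 : 0 ≤ V i) : propP V i ≤ V i := by
  by_cases h : 1 ≤ ∑ j, V j
  · rw [propP_of_one_le h]
    exact div_le_self h0 h
  · rwa [propP_of_not_one_le h]

theorem sum_propP {n : ℕ} {V : Fin n → ℝ} (h : 1 ≤ ∑ j, V j) : ∑ i, propP V i = 1 := by
  simp only [propP_of_one_le h]
  rw [← Finset.sum_div, div_self (by linarith)]

theorem propP_utility_mono {n : ℕ} {V V' : Fin n → ℝ} (h0 : ∀ i, 0 ≤ V' i)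
    (hle : ∀ i, V' i ≤ V i) (i : Fin n) :
    V' i * (if 1 ≤ ∑ j, V' j then 1 else 0) - propP V' i ≤
      V i * (if 1 ≤ ∑ j, V j then 1 else 0) - propP V i := by
  have hS : ∑ j, V' j ≤ ∑ j, V j := Finset.sum_le_sum fun j _ => hle j
  have hV : 0 ≤ V i := (h0 i).trans (hle i)
  by_cases h' : 1 ≤ ∑ j, V' j
  · have h : 1 ≤ ∑ j, V j := h'.trans hS
    rw [if_pos h', if_pos h, propP_of_one_le h', propP_of_one_le h, div_eq_mul_inv,
      div_eq_mul_inv, ← mul_sub, ← mul_sub]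
    have hinv : (∑ j, V j)⁻¹ ≤ (∑ j, V' j)⁻¹ := inv_anti₀ (by linarith) hS
    have hone : (∑ j, V j)⁻¹ ≤ 1 := inv_le_one_of_one_le₀ h
    exact mul_le_mul (hle i) (by linarith) (by linarith [inv_le_one_of_one_le₀ h']) hV
  · rw [if_neg h', propP_of_not_one_le h', mul_zero, sub_zero]
    by_cases h : 1 ≤ ∑ j, V j
    · rw [if_pos h, mul_one]
      exact sub_nonneg.2 (propP_le hV)
    · simp [h, propP_of_not_one_le h]

theorem propP_stable {n : ℕ} {V : Fin n → ℝ} (h0 : ∀ j, 0 ≤ V j) (i : Fin n) {W : ℝ}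
    (hW : V i ≤ W) :
    V i * (if i ∈ propA (Function.update V i W) then 1 else 0)
        - propP (Function.update V i W) i ≤
      V i * (if i ∈ propA V then 1 else 0) - propP V i := by
  have hr : 0 ≤ ∑ j ∈ Finset.univ \ {i}, V j := Finset.sum_nonneg fun j _ => h0 j
  have hV : ∑ j, V j = V i + ∑ j ∈ Finset.univ \ {i}, V j :=
    Finset.sum_eq_add_sum_sdiff_singleton_of_mem (Finset.mem_univ i) V
  have hU : ∑ j, Function.update V i W j = W + ∑ j ∈ Finset.univ \ {i}, V j :=
    Finset.sum_update_of_mem (Finset.mem_univ i) V W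
  have hi := h0 i
  simp only [mem_propA, propP, Function.update_self, hU, hV]
  generalize ∑ j ∈ Finset.univ \ {i}, V j = r at hr
  by_cases h : 1 ≤ V i + r
  · have h' : 1 ≤ W + r := by linarith
    rw [if_pos h, if_pos h, if_pos h', if_pos h']
    refine sub_le_sub_left ?_ _
    rw [div_le_div_iff₀ (by linarith) (by linarith)]
    nlinarith
  · rw [if_neg h, if_neg h]
    by_cases h' : 1 ≤ W + r
    · rw [if_pos h', if_pos h', mul_one, mul_zero, sub_zero, sub_nonpos,
        le_div_iff₀ (by linarith)]
      have h1 : V i * r ≤ V i * (1 - V i) := mul_le_mul_of_nonneg_left (by linarith) hi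
      have h2 : V i * (1 - V i) ≤ W * (1 - V i) :=
        mul_le_mul_of_nonneg_right hW (by linarith)
      linarith
    · rw [if_neg h', if_neg h']

theorem propA_deadweight_loss {n : ℕ} (V : Fin n → ℝ) :
    max (∑ i ∈ (propA V)ᶜ, V i + ∑ i, propP V i - 1) 0 = 0 := by
  by_cases h : 1 ≤ ∑ j, V j
  · simp [sum_propP h, propA, h]
  · simp only [propP_of_not_one_le h, propA, if_neg h]
    simpa using (not_le.1 h).le

/-- The proportional mechanism satisfies (i) individual rationality
and exact cost covering, (ii) utility monotonicity (MT3), (iii) payment stability (PS),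
and (iv) has zero dead-weight loss everywhere. -/
theorem statement19 {n : ℕ} :
    -- (i) (IR), and exact budget balance whenever the good is allocated, hence (CC)
    (∀ V : Fin n → ℝ, (∀ i, 0 ≤ V i) →
      (∀ i, (i ∈ propA V → propP V i ≤ V i) ∧ (i ∉ propA V → propP V i = 0)) ∧
      (1 ≤ ∑ j, V j → ∑ i, propP V i = 1)) ∧
    -- (ii) (MT3)
    (∀ V V' : Fin n → ℝ, (∀ i, 0 ≤ V' i) → (∀ i, V' i ≤ V i) → ∀ i,
      V' i * (if 1 ≤ ∑ j, V' j then 1 else 0) - propP V' i ≤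
        V i * (if 1 ≤ ∑ j, V j then 1 else 0) - propP V i) ∧
    -- (iii) (PS): over-reporting `W ≥ Ṽ_i` cannot increase true quasi-linear utility
    (∀ (i : Fin n) (V : Fin n → ℝ), (∀ j, 0 ≤ V j) → ∀ W : ℝ, V i ≤ W →
      V i * (if i ∈ propA (Function.update V i W) then 1 else 0)
          - propP (Function.update V i W) i ≤
        V i * (if i ∈ propA V then 1 else 0) - propP V i) ∧
    -- (iv) zero dead-weight loss
    (∀ V : Fin n → ℝ, (∀ i, 0 ≤ V i) →
      max (∑ i ∈ (propA V)ᶜ, V i + ∑ i, propP V i - 1) 0 = 0) := by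
  refine ⟨fun V h0 => ⟨fun i => ⟨fun _ => propP_le (h0 i), fun hi => ?_⟩, sum_propP⟩,
    fun V V' h0 hle i => propP_utility_mono h0 hle i,
    fun i V h0 W hW => propP_stable h0 i hW, fun V _ => propA_deadweight_loss V⟩
  exact propP_of_not_one_le (fun h => hi (mem_propA.2 h)) i
end
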